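/- Let M be a matroid without large uniform minors. Then the following are equivalent: (a) M is representable over 𝔽₃; (b) M is representable over some field of characteristic 3; (c) M is representable over every field of characteristic 3. -/

import Mathlib

universe u v w

open Matroid Set

namespace Paper

/-- The deletion of the set `D` from the matroid `M`. -/
def delete {α : Type u} (M : Matroid α) (D : Set α) : Matroid α := M ↾ (M.E \ D)

/-- The contraction of the set `C` in the matroid `M`. -/
def contract {α : Type u} (M : Matroid α) (C : Set α) : Matroid α := (delete M✶ C)✶

/-- `N` is a minor of `M`: it is obtained from `M` by a sequence of deletions and
contractions, equivalently by a single contraction followed by a single deletion. -/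
def IsMinor {α : Type u} (N M : Matroid α) : Prop :=
  ∃ C D : Set α, N = delete (contract M C) D

/-- `M` is a copy of the uniform matroid `U(r,n)`: its ground set has `n` elements and its
independent sets are exactly the subsets of the ground set with at most `r` elements. -/
def IsUniform {α : Type u} (M : Matroid α) (r n : ℕ) : Prop :=
  M.E.Finite ∧ M.E.ncard = n ∧ ∀ I ⊆ M.E, (M.Indep I ↔ I.ncard ≤ r)

/-- `M` has a minor isomorphic to the uniform matroid `U(r,n)`. -/
def HasUniformMinor {α : Type u} (M : Matroid α) (r n : ℕ) : Prop :=
  ∃ N : Matroid α, IsMinor N M ∧ IsUniform N r n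

/-- `M` is without large uniform minors: no minor of `M` is isomorphic to `U(2,5)` or
`U(3,5)`. -/
def NoLargeUniformMinors {α : Type u} (M : Matroid α) : Prop :=
  ¬ HasUniformMinor M 2 5 ∧ ¬ HasUniformMinor M 3 5

/-- `M` is isomorphic to the Fano matroid `F₇`, the matroid on the seven nonzero vectors of
`(𝔽₂)³` whose independent sets are the `𝔽₂`-linearly independent subsets. -/
def IsFano {α : Type u} (M : Matroid α) : Prop :=
  ∃ f : α → (Fin 3 → ZMod 2),
    Set.BijOn f M.E {x | x ≠ 0} ∧
    ∀ I ⊆ M.E, (M.Indep I ↔ Set.InjOn f I ∧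
      LinearIndependent (ZMod 2) (fun x : (f '' I) => (x : Fin 3 → ZMod 2)))

/-- `M` has a minor isomorphic to the Fano matroid `F₇`. -/
def HasFanoMinor {α : Type u} (M : Matroid α) : Prop :=
  ∃ N : Matroid α, IsMinor N M ∧ IsFano N

/-- `M` has a minor isomorphic to the dual Fano matroid `F₇*`. -/
def HasFanoDualMinor {α : Type u} (M : Matroid α) : Prop :=
  ∃ N : Matroid α, IsMinor N M ∧ IsFano N✶

/-- `M` is representable over the field `K`: there are a `K`-vector space `V` and a map
`φ` from the ground type to `V` such that a set `I ⊆ M.E` is independent in `M` if and only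
if the family `φ` restricted to `I` is linearly independent over `K` (equivalently, `φ` is
injective on `I` and the image `φ '' I` is linearly independent). -/
def Representable {α : Type u} (M : Matroid α) (K : Type v) [Field K] : Prop :=
  ∃ (V : Type (max u v)) (_ : AddCommGroup V) (_ : Module K V) (φ : α → V),
    ∀ I ⊆ M.E, (M.Indep I ↔ LinearIndependent K (fun x : I => φ x))

end Paper

namespace Paper

section Pivot

variable {R : Type*} {C : Type*} {F : Type*} [Field F]

open Classical in
/-- The matrix obtained from `A` by pivoting on the entry `(r, c)`, with rows and columns rescaled
so that the operation is an involution and commutes with transposition. -/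
noncomputable def pivot (A : Matrix R C F) (r : R) (c : C) : Matrix R C F := fun i j =>
  if i = r then (if j = c then -A r c else A r j)
  else if j = c then A i c else A i j - A i c * A r j / A r c

lemma pivot_self (A : Matrix R C F) (r : R) (c : C) : pivot A r c r c = -A r c := by
  simp [pivot]

lemma pivot_row (A : Matrix R C F) (r : R) {c j : C} (hj : j ≠ c) :
    pivot A r c r j = A r j := by
  simp [pivot, hj]

lemma pivot_col (A : Matrix R C F) {r i : R} (hi : i ≠ r) (c : C) :
    pivot A r c i c = A i c := by
  simp [pivot, hi]

lemma pivot_of_ne (A : Matrix R C F) {r i : R} {c j : C} (hi : i ≠ r) (hj : j ≠ c) :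
    pivot A r c i j = A i j - A i c * A r j / A r c := by
  simp [pivot, hi, hj]

lemma pivot_pivot (A : Matrix R C F) {r : R} {c : C} (h : A r c ≠ 0) :
    pivot (pivot A r c) r c = A := by
  ext i j
  by_cases hi : i = r <;> by_cases hj : j = c
  · subst hi hj; simp [pivot_self]
  · subst hi; rw [pivot_row _ _ hj, pivot_row _ _ hj]
  · subst hj; rw [pivot_col _ hi, pivot_col _ hi]
  · rw [pivot_of_ne _ hi hj, pivot_of_ne _ hi hj, pivot_col _ hi, pivot_row _ _ hj, pivot_self]
    field_simp
    ring

lemma pivot_transpose (A : Matrix R C F) (r : R) (c : C) :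
    (pivot A r c).transpose = pivot A.transpose c r := by
  ext j i
  simp only [pivot, Matrix.transpose_apply]
  split_ifs <;> simp [mul_comm]

/-- A row that vanishes in the pivot column is unchanged by the pivot. -/
lemma pivot_row_of_eq_zero {A : Matrix R C F} {r : R} {c : C} (h : A r c ≠ 0) {i : R}
    (hi : A i c = 0) (j : C) : pivot A r c i j = A i j := by
  have hir : i ≠ r := by rintro rfl; exact h hi
  by_cases hj : j = c
  · subst hj; exact pivot_col _ hir _
  · simp [pivot_of_ne _ hir hj, hi]

/-- A column that vanishes in the pivot row is unchanged by the pivot. -/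
lemma pivot_col_of_eq_zero {A : Matrix R C F} {r : R} {c : C} (h : A r c ≠ 0) {j : C}
    (hj : A r j = 0) (i : R) : pivot A r c i j = A i j := by
  have := pivot_row_of_eq_zero (A := A.transpose) (r := c) (c := r) h (i := j) hj i
  rwa [← pivot_transpose] at this

lemma det_eq_mul_det_schur {n : ℕ} (M : Matrix (Fin (n + 1)) (Fin (n + 1)) F) (h : M 0 0 ≠ 0) :
    M.det = M 0 0 * (Matrix.of fun i j : Fin n =>
      M i.succ j.succ - M i.succ 0 * M 0 j.succ / M 0 0).det := by
  have key : M.det = (Matrix.of (fun i j : Fin (n + 1) =>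
      M i j - (if i = 0 then 0 else M i 0 / M 0 0) * M 0 j)).det := by
    refine Matrix.det_eq_of_forall_row_eq_smul_add_const
      (fun i => if i = 0 then 0 else M i 0 / M 0 0) 0 (by simp) ?_
    intro i j
    simp
  rw [key, Matrix.det_succ_column_zero, Finset.sum_eq_single 0]
  · simp only [Fin.coe_ofNat_eq_mod, Nat.zero_mod, pow_zero, Matrix.of_apply, if_true, zero_mul,
      sub_zero, one_mul]
    congr 2
    ext i j
    simp only [Matrix.submatrix_apply, Matrix.of_apply, Fin.succAbove_zero, Fin.succ_ne_zero,
      if_false]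
    ring
  · intro i _ hi
    simp only [Matrix.of_apply, if_neg hi]
    rw [div_mul_cancel₀ _ h]
    simp
  · simp

lemma det_submatrix_cons {n : ℕ} {A : Matrix R C F} {r : R} {c : C} (h : A r c ≠ 0)
    {f : Fin n → R} {g : Fin n → C} (hf : ∀ k, f k ≠ r) (hg : ∀ k, g k ≠ c) :
    (A.submatrix (Fin.cons r f : Fin (n + 1) → R) (Fin.cons c g : Fin (n + 1) → C)).det =
      A r c * ((pivot A r c).submatrix f g).det := by
  rw [det_eq_mul_det_schur _ (by simpa using h)]
  simp only [Matrix.submatrix_apply, Fin.cons_zero, Fin.cons_succ]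
  congr 2
  ext i j
  simp [pivot_of_ne _ (hf i) (hg j)]

lemma det_pivot_submatrix_cons {n : ℕ} {A : Matrix R C F} {r : R} {c : C} (h : A r c ≠ 0)
    {f : Fin n → R} {g : Fin n → C} (hf : ∀ k, f k ≠ r) (hg : ∀ k, g k ≠ c) :
    ((pivot A r c).submatrix (Fin.cons r f : Fin (n + 1) → R)
      (Fin.cons c g : Fin (n + 1) → C)).det = -A r c * (A.submatrix f g).det := by
  rw [det_submatrix_cons (A := pivot A r c) (by simpa [pivot_self] using h) hf hg,
    pivot_pivot _ h, pivot_self]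

lemma det_pivot_submatrix_of_row_mem {n : ℕ} {A : Matrix R C F} {r : R} {c : C}
    {f : Fin n → R} {g : Fin n → C} (hf : Function.Injective f) {a : Fin n} (ha : f a = r)
    (hg : ∀ k, g k ≠ c) :
    ((pivot A r c).submatrix f g).det = (A.submatrix f g).det := by
  symm
  refine Matrix.det_eq_of_forall_row_eq_smul_add_const
    (fun i => if i = a then 0 else A (f i) c / A r c) a (by simp) ?_
  intro i j
  simp only [Matrix.submatrix_apply, ha, pivot_row _ _ (hg j)]
  by_cases hi : i = a
  · subst hi; simp [ha, pivot_row _ _ (hg j)]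
  · rw [pivot_of_ne _ (fun h => hi (hf (h.trans ha.symm))) (hg j), if_neg hi]
    ring

lemma det_pivot_submatrix_of_col_mem {n : ℕ} {A : Matrix R C F} {r : R} {c : C}
    {f : Fin n → R} {g : Fin n → C} (hg : Function.Injective g) {b : Fin n} (hb : g b = c)
    (hf : ∀ k, f k ≠ r) :
    ((pivot A r c).submatrix f g).det = (A.submatrix f g).det := by
  have := det_pivot_submatrix_of_row_mem (A := A.transpose) (r := c) (c := r) hg hb hf
  rw [← pivot_transpose] at this
  rwa [← Matrix.det_transpose, ← Matrix.det_transpose (A.submatrix f g)]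

lemma det_submatrix_perm_eq_zero_iff {n : ℕ} (A : Matrix R C F) (f : Fin n → R) (g : Fin n → C)
    (σ τ : Equiv.Perm (Fin n)) :
    (A.submatrix (f ∘ σ) (g ∘ τ)).det = 0 ↔ (A.submatrix f g).det = 0 := by
  have h1 := Matrix.det_permute σ ((A.submatrix f g).submatrix id τ)
  have h2 := Matrix.det_permute' τ (A.submatrix f g)
  have h3 : A.submatrix (f ∘ σ) (g ∘ τ) = ((A.submatrix f g).submatrix id τ).submatrix σ id := rfl
  rw [h3, h1, h2]
  rcases Int.units_eq_one_or (Equiv.Perm.sign σ) with h | h <;>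
    rcases Int.units_eq_one_or (Equiv.Perm.sign τ) with h' | h' <;> simp [h, h']

lemma det_submatrix_eq_zero_of_not_injective {n : ℕ} (A : Matrix R C F) {f : Fin n → R}
    {g : Fin n → C} (h : ¬ (Function.Injective f ∧ Function.Injective g)) :
    (A.submatrix f g).det = 0 := by
  rw [not_and_or] at h
  rcases h with h | h <;> simp only [Function.Injective, not_forall] at h <;>
    obtain ⟨a, b, hab, hne⟩ := h
  · exact Matrix.det_zero_of_row_eq hne (by ext; simp [hab])
  · exact Matrix.det_zero_of_column_eq hne (by simp [hab])

/-- A pair of positions can be moved to the front of an index family. -/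
lemma exists_perm_comp_eq_cons {ι : Type*} {n : ℕ} (f : Fin (n + 1) → ι) (a : Fin (n + 1)) :
    ∃ (σ : Equiv.Perm (Fin (n + 1))) (f₀ : Fin n → ι),
      f ∘ σ = (Fin.cons (f a) f₀ : Fin (n + 1) → ι) := by
  refine ⟨Equiv.swap 0 a, fun k => f (Equiv.swap 0 a k.succ), ?_⟩
  ext k
  refine Fin.cases ?_ (fun k => ?_) k <;> simp

end Pivot

section Sync

variable {R : Type*} {C : Type*} {F G : Type*} [Field F] [Field G]

/-- The matrices `A` and `T` have the same vanishing subdeterminants among the rows and columns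
in `S`. -/
def Sync (S : Set (R ⊕ C)) (A : Matrix R C F) (T : Matrix R C G) : Prop :=
  ∀ (n : ℕ) (f : Fin n → R) (g : Fin n → C), (∀ k, Sum.inl (f k) ∈ S) → (∀ k, Sum.inr (g k) ∈ S) →
    ((A.submatrix f g).det = 0 ↔ (T.submatrix f g).det = 0)

variable {S : Set (R ⊕ C)} {A : Matrix R C F} {T : Matrix R C G}

lemma Sync.mono {S' : Set (R ⊕ C)} (h : Sync S A T) (hS : S' ⊆ S) : Sync S' A T :=
  fun n f g hf hg => h n f g (fun k => hS (hf k)) (fun k => hS (hg k))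

lemma Sync.symm (h : Sync S A T) : Sync S T A := fun n f g hf hg => (h n f g hf hg).symm

lemma Sync.entry (h : Sync S A T) {i : R} {j : C} (hi : Sum.inl i ∈ S) (hj : Sum.inr j ∈ S) :
    A i j = 0 ↔ T i j = 0 := by
  have := h 1 ![i] ![j] (by simpa) (by simpa)
  rw [Matrix.det_fin_one, Matrix.det_fin_one] at this
  exact this

lemma Sync.entry_ne (h : Sync S A T) {i : R} {j : C} (hi : Sum.inl i ∈ S) (hj : Sum.inr j ∈ S) :
    A i j ≠ 0 ↔ T i j ≠ 0 := (h.entry hi hj).not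

lemma Sync.two (h : Sync S A T) {i i' : R} {j j' : C} (hi : Sum.inl i ∈ S) (hi' : Sum.inl i' ∈ S)
    (hj : Sum.inr j ∈ S) (hj' : Sum.inr j' ∈ S) :
    A i j * A i' j' - A i j' * A i' j = 0 ↔ T i j * T i' j' - T i j' * T i' j = 0 := by
  have := h 2 ![i, i'] ![j, j'] (by simp [Fin.forall_fin_two, hi, hi'])
    (by simp [Fin.forall_fin_two, hj, hj'])
  rw [Matrix.det_fin_two, Matrix.det_fin_two] at this
  exact this

lemma Sync.congr {T' : Matrix R C G} (h : Sync S A T)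
    (hT : ∀ i j, Sum.inl i ∈ S → Sum.inr j ∈ S → T' i j = T i j) : Sync S A T' := by
  intro n f g hf hg
  rw [h n f g hf hg]
  have : T'.submatrix f g = T.submatrix f g := by
    ext i j; exact hT _ _ (hf i) (hg j)
  rw [this]

lemma Sync.transpose (h : Sync S A T) : Sync (Sum.swap ⁻¹' S) A.transpose T.transpose := by
  intro n f g hf hg
  rw [← Matrix.det_transpose, ← Matrix.det_transpose (T.transpose.submatrix f g)]
  exact h n g f hg hf

lemma Sync.scale (h : Sync S A T) {d : R → G} {e : C → G} (hd : ∀ i, d i ≠ 0)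
    (he : ∀ j, e j ≠ 0) : Sync S A (Matrix.of fun i j => d i * T i j * e j) := by
  intro n f g hf hg
  have h1 : (Matrix.of fun i j => d i * T i j * e j).submatrix f g = Matrix.of fun i j =>
      e (g j) * (Matrix.of fun i j => d (f i) * T.submatrix f g i j) i j := by
    ext i j; simp; ring
  rw [h n f g hf hg, h1, Matrix.det_mul_row, Matrix.det_mul_column]
  simp [Finset.prod_eq_zero_iff, hd, he]

lemma Sync.pivot (h : Sync S A T) {r : R} {c : C} (hr : Sum.inl r ∈ S) (hc : Sum.inr c ∈ S)
    (hA : A r c ≠ 0) : Sync S (pivot A r c) (pivot T r c) := by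
  have hT := (h.entry_ne hr hc).1 hA
  intro n f g hf hg
  by_cases hinj : Function.Injective f ∧ Function.Injective g
  swap
  · simp [det_submatrix_eq_zero_of_not_injective _ hinj]
  obtain ⟨fi, gi⟩ := hinj
  by_cases hrf : ∃ a, f a = r <;> by_cases hcg : ∃ b, g b = c
  · obtain ⟨a, ha⟩ := hrf
    obtain ⟨b, hb⟩ := hcg
    cases n with
    | zero => exact a.elim0
    | succ n =>
      obtain ⟨σ, f₀, hσ⟩ := exists_perm_comp_eq_cons f a
      obtain ⟨τ, g₀, hτ⟩ := exists_perm_comp_eq_cons g b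
      rw [← det_submatrix_perm_eq_zero_iff _ f g σ τ, ← det_submatrix_perm_eq_zero_iff _ f g σ τ]
      have fi' : Function.Injective (f ∘ σ) := fi.comp σ.injective
      have gi' : Function.Injective (g ∘ τ) := gi.comp τ.injective
      have hf' : ∀ k, Sum.inl ((f ∘ σ) k) ∈ S := fun k => hf _
      have hg' : ∀ k, Sum.inr ((g ∘ τ) k) ∈ S := fun k => hg _
      rw [hσ, ha] at fi' hf' ⊢
      rw [hτ, hb] at gi' hg' ⊢
      have hf0 : ∀ k, f₀ k ≠ r := fun k hk => Fin.succ_ne_zero k (fi' (by simpa using hk))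
      have hg0 : ∀ k, g₀ k ≠ c := fun k hk => Fin.succ_ne_zero k (gi' (by simpa using hk))
      rw [det_pivot_submatrix_cons hA hf0 hg0, det_pivot_submatrix_cons hT hf0 hg0]
      simpa [hA, hT] using h n f₀ g₀ (fun k => by simpa using hf' k.succ)
        (fun k => by simpa using hg' k.succ)
  · obtain ⟨a, ha⟩ := hrf
    rw [not_exists] at hcg
    rw [det_pivot_submatrix_of_row_mem fi ha hcg, det_pivot_submatrix_of_row_mem fi ha hcg]
    exact h n f g hf hg
  · obtain ⟨b, hb⟩ := hcg
    rw [not_exists] at hrf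
    rw [det_pivot_submatrix_of_col_mem gi hb hrf, det_pivot_submatrix_of_col_mem gi hb hrf]
    exact h n f g hf hg
  · rw [not_exists] at hrf hcg
    have := h (n + 1) (Fin.cons r f) (Fin.cons c g) (Fin.cases (by simpa) (by simpa))
      (Fin.cases (by simpa) (by simpa))
    rw [det_submatrix_cons hA hrf hcg, det_submatrix_cons hT hrf hcg] at this
    simpa [hA, hT] using this

/-- If a relation between matrices is preserved by pivots in columns outside `X`, and related
matrices have the same support and the same vanishing subdeterminants in the columns of `X`, then
related matrices have the same vanishing subdeterminants. -/
lemma sync_of_pivot_closed (P : Matrix R C F → Matrix R C G → Prop) (X : Set C)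
    (hsupp : ∀ A T, P A T → ∀ i j, Sum.inl i ∈ S → Sum.inr j ∈ S → (A i j = 0 ↔ T i j = 0))
    (hX : ∀ A T, P A T → ∀ (n : ℕ) (f : Fin n → R) (g : Fin n → C), (∀ k, Sum.inl (f k) ∈ S) →
      (∀ k, Sum.inr (g k) ∈ S) → (∀ k, g k ∈ X) → Function.Injective g →
      ((A.submatrix f g).det = 0 ↔ (T.submatrix f g).det = 0))
    (hpiv : ∀ A T, P A T → ∀ r c, Sum.inl r ∈ S → Sum.inr c ∈ S → c ∉ X → A r c ≠ 0 →
      P (Paper.pivot A r c) (Paper.pivot T r c))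
    (h : P A T) : Sync S A T := by
  intro n
  induction n generalizing A T with
  | zero => intro f g _ _; simp
  | succ n ih =>
    intro f g hf hg
    by_cases hinj : Function.Injective f ∧ Function.Injective g
    swap
    · simp [det_submatrix_eq_zero_of_not_injective _ hinj]
    obtain ⟨fi, gi⟩ := hinj
    by_cases hgX : ∀ k, g k ∈ X
    · exact hX A T h _ f g hf hg hgX gi
    rw [not_forall] at hgX
    obtain ⟨b, hb⟩ := hgX
    by_cases h0 : ∀ a, A (f a) (g b) = 0
    · exact iff_of_true (Matrix.det_eq_zero_of_column_eq_zero b h0)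
        (Matrix.det_eq_zero_of_column_eq_zero b
          fun a => (hsupp A T h _ _ (hf a) (hg b)).1 (h0 a))
    rw [not_forall] at h0
    obtain ⟨a, hA⟩ := h0
    have hT := (hsupp A T h _ _ (hf a) (hg b)).not.1 hA
    obtain ⟨σ, f₀, hσ⟩ := exists_perm_comp_eq_cons f a
    obtain ⟨τ, g₀, hτ⟩ := exists_perm_comp_eq_cons g b
    rw [← det_submatrix_perm_eq_zero_iff _ f g σ τ, ← det_submatrix_perm_eq_zero_iff _ f g σ τ]
    have fi' : Function.Injective (f ∘ σ) := fi.comp σ.injective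
    have gi' : Function.Injective (g ∘ τ) := gi.comp τ.injective
    have hf' : ∀ k, Sum.inl ((f ∘ σ) k) ∈ S := fun k => hf _
    have hg' : ∀ k, Sum.inr ((g ∘ τ) k) ∈ S := fun k => hg _
    rw [hσ] at fi' hf' ⊢
    rw [hτ] at gi' hg' ⊢
    have hf0 : ∀ k, f₀ k ≠ f a := fun k hk => Fin.succ_ne_zero k (fi' (by simpa using hk))
    have hg0 : ∀ k, g₀ k ≠ g b := fun k hk => Fin.succ_ne_zero k (gi' (by simpa using hk))
    rw [det_submatrix_cons hA hf0 hg0, det_submatrix_cons hT hf0 hg0]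
    simpa [hA, hT] using ih (hpiv A T h _ _ (hf a) (hg b) hb hA) f₀ g₀
      (fun k => by simpa using hf' k.succ) (fun k => by simpa using hg' k.succ)

end Sync

end Paper

namespace Paper

section Connectivity

variable {R : Type*} {C : Type*} {F : Type*} [Field F]

/-- `U` is a union of components of the bipartite graph on `S` given by the support of `A`. -/
def Closed (A : Matrix R C F) (S U : Set (R ⊕ C)) : Prop :=
  ∀ i j, Sum.inl i ∈ S → Sum.inr j ∈ S → A i j ≠ 0 → (Sum.inl i ∈ U ↔ Sum.inr j ∈ U)

/-- The bipartite graph on `S` given by the support of `A` has at most one component. -/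
def Conn (A : Matrix R C F) (S : Set (R ⊕ C)) : Prop :=
  ∀ U ⊆ S, U.Nonempty → Closed A S U → S ⊆ U

/-- Adjacency in the bipartite graph given by the support of `A`. -/
def Adj (A : Matrix R C F) : R ⊕ C → R ⊕ C → Prop
  | .inl i, .inr j => A i j ≠ 0
  | .inr j, .inl i => A i j ≠ 0
  | _, _ => False

variable {A : Matrix R C F} {S V U : Set (R ⊕ C)}

lemma Closed.transpose (h : Closed A S U) :
    Closed A.transpose (Sum.swap ⁻¹' S) (Sum.swap ⁻¹' U) :=
  fun i j hi hj hA => (h j i hj hi hA).symm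

lemma Conn.transpose (h : Conn A S) : Conn A.transpose (Sum.swap ⁻¹' S) := by
  intro U hU hne hcl x hx
  have hs : Sum.swap ⁻¹' (Sum.swap ⁻¹' S) = S := by ext; simp
  have := h (Sum.swap ⁻¹' U) (fun y hy => by simpa using hU hy)
    (by obtain ⟨u, hu⟩ := hne; exact ⟨u.swap, by simpa⟩)
    (by simpa [hs] using hcl.transpose) hx
  simpa using this

lemma Closed.pivot (h : Closed A S U) {r : R} {c : C} (hr : Sum.inl r ∈ S) (hc : Sum.inr c ∈ S)
    (hA : A r c ≠ 0) : Closed (pivot A r c) S U := by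
  intro i j hi hj hp
  by_cases hir : i = r <;> by_cases hjc : j = c
  · subst hir hjc; exact h _ _ hi hj hA
  · subst hir; rw [pivot_row _ _ hjc] at hp; exact h _ _ hi hj hp
  · subst hjc; rw [pivot_col _ hir] at hp; exact h _ _ hi hj hp
  · rw [pivot_of_ne _ hir hjc] at hp
    by_cases hij : A i j = 0
    · have h1 : A i c ≠ 0 := by rintro h0; simp [hij, h0] at hp
      have h2 : A r j ≠ 0 := by rintro h0; simp [hij, h0] at hp
      rw [h _ _ hi hc h1, ← h _ _ hr hc hA, h _ _ hr hj h2]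
    · exact h _ _ hi hj hij

lemma Conn.pivot (h : Conn A S) {r : R} {c : C} (hr : Sum.inl r ∈ S) (hc : Sum.inr c ∈ S)
    (hA : A r c ≠ 0) : Conn (pivot A r c) S := by
  intro U hU hne hcl
  refine h U hU hne ?_
  have := hcl.pivot hr hc (by simpa [pivot_self] using hA)
  rwa [pivot_pivot _ hA] at this

lemma Closed.adj (h : Closed A S U) {u w : R ⊕ C} (hu : u ∈ S) (hw : w ∈ S) (huw : Adj A u w) :
    u ∈ U ↔ w ∈ U := by
  rcases u with i | j <;> rcases w with i' | j'
  · exact huw.elim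
  · exact h _ _ hu hw huw
  · exact (h _ _ hw hu huw).symm
  · exact huw.elim

lemma Closed.mono {S' : Set (R ⊕ C)} (h : Closed A S U) (hS : S' ⊆ S) : Closed A S' (U ∩ S') :=
  fun i j hi hj hA => by simp [hi, hj, h i j (hS hi) (hS hj) hA]

lemma conn_singleton (v : R ⊕ C) : Conn A {v} := by
  rintro U hU ⟨u, hu⟩ _ x rfl
  rwa [← Set.mem_singleton_iff.1 (hU hu)]

lemma conn_star {v : R ⊕ C} (hv : v ∈ S) (h : ∀ w ∈ S, w ≠ v → Adj A v w) : Conn A S := by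
  rintro U hU ⟨u, hu⟩ hcl
  have hvU : v ∈ U := by
    by_cases huv : u = v
    · rwa [← huv]
    · exact (hcl.adj hv (hU hu) (h u (hU hu) huv)).2 hu
  intro w hw
  by_cases hwv : w = v
  · rwa [hwv]
  · exact (hcl.adj hv hw (h w hw hwv)).1 hvU

lemma Conn.insert (h : Conn A S) {s w : R ⊕ C} (hs : s ∈ S) (hsw : Adj A s w) :
    Conn A (insert w S) := by
  rintro U hU ⟨u, hu⟩ hcl
  have hadj := hcl.adj (Set.mem_insert_of_mem _ hs) (Set.mem_insert _ _) hsw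
  have hne : (U ∩ S).Nonempty := by
    rcases hU hu with rfl | huS
    · exact ⟨s, hadj.2 hu, hs⟩
    · exact ⟨u, hu, huS⟩
  have hSU : S ⊆ U := fun x hx =>
    (h (U ∩ S) Set.inter_subset_right hne (hcl.mono (Set.subset_insert _ _)) hx).1
  exact Set.insert_subset (hadj.1 (hSU hs)) hSU

lemma Conn.exists_adj (h : Conn A V) (hSV : S ⊆ V) (hS : S.Nonempty) (hne : ¬ V ⊆ S) :
    ∃ s ∈ S, ∃ w ∈ V, w ∉ S ∧ Adj A s w := by
  by_contra! hcon
  refine hne (h S hSV hS fun i j hi hj hA => ⟨fun hi' => ?_, fun hj' => ?_⟩)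
  · by_contra hj'
    exact hcon _ hi' _ hj hj' hA
  · by_contra hi'
    exact hcon _ hj' _ hi hi' hA

/-- A connected finite graph can be grown vertex by vertex from any nonempty set of vertices. -/
lemma Conn.grow (h : Conn A V) (hV : V.Finite) (P : Set (R ⊕ C) → Prop) (hSV : S ⊆ V)
    (hS : S.Nonempty) (hP : P S)
    (step : ∀ S' ⊆ V, P S' → ∀ s ∈ S', ∀ w ∈ V, w ∉ S' → Adj A s w → P (Insert.insert w S')) :
    P V := by
  induction hn : (V \ S).ncard using Nat.strong_induction_on generalizing S with
  | _ n ih =>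
  subst hn
  by_cases hVS : V ⊆ S
  · rwa [hVS.antisymm hSV]
  obtain ⟨s, hs, w, hw, hwS, hsw⟩ := h.exists_adj hSV hS hVS
  have hlt : (V \ Insert.insert w S).ncard < (V \ S).ncard :=
    Set.ncard_lt_ncard ⟨Set.sdiff_subset_sdiff_right (Set.subset_insert _ _),
      fun hsub => (hsub ⟨hw, hwS⟩).2 (Set.mem_insert _ _)⟩ (hV.subset Set.sdiff_subset)
  exact ih _ hlt (Set.insert_subset hw hSV) (Set.insert_nonempty _ _)
    (step S hSV hP s hs w hw hwS hsw) rfl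

/-- In a finite connected bipartite graph with a vertex of degree at least three, there are two
vertices on the same side whose removal leaves a connected graph. -/
lemma Conn.exists_pair (h : Conn A V) (hV : V.Finite) {v : R ⊕ C} {N : Set (R ⊕ C)} (hv : v ∈ V)
    (hN : N ⊆ V) (hN3 : N.ncard = 3) (hadj : ∀ w ∈ N, Adj A v w) :
    (∃ x y, x ≠ y ∧ Sum.inr x ∈ V ∧ Sum.inr y ∈ V ∧ Conn A (V \ {Sum.inr x, Sum.inr y})) ∨
    (∃ x y, x ≠ y ∧ Sum.inl x ∈ V ∧ Sum.inl y ∈ V ∧ Conn A (V \ {Sum.inl x, Sum.inl y})) := by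
  have key : ∃ N' ⊆ V, N'.ncard = 3 ∧ ∀ L ⊆ N', Conn A (V \ L) := by
    have hvN : v ∉ N := fun hvN => by
      have := hadj v hvN
      rcases v with i | j <;> exact this
    refine h.grow (S := Insert.insert v N) hV
      (fun S => ∃ N' ⊆ S, N'.ncard = 3 ∧ ∀ L ⊆ N', Conn A (S \ L))
      (Set.insert_subset hv hN) (Set.insert_nonempty _ _) ?_ ?_
    · refine ⟨N, Set.subset_insert _ _, hN3, fun L hL => conn_star (v := v) ?_ ?_⟩
      · exact ⟨Set.mem_insert _ _, fun hvL => hvN (hL hvL)⟩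
      · rintro w ⟨rfl | hw, _⟩ hwv
        · exact absurd rfl hwv
        · exact hadj w hw
    · rintro S hSV ⟨N', hN'S, hN'3, hconn⟩ s hs w hw hwS hsw
      have hwN' : w ∉ N' := fun h => hwS (hN'S h)
      by_cases hsN' : s ∈ N'
      · refine ⟨Insert.insert w (N' \ {s}),
          Set.insert_subset_insert (Set.sdiff_subset.trans hN'S), ?_, fun L hL => ?_⟩
        · have hfin : N'.Finite := (hV.subset hSV).subset hN'S
          rw [Set.ncard_insert_of_notMem (fun h => hwN' h.1) (hfin.subset Set.sdiff_subset),
            Set.ncard_sdiff_singleton_of_mem hsN', hN'3]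
        · by_cases hwL : w ∈ L
          · have : Insert.insert w S \ L = S \ (L \ {w}) := by
              ext u
              by_cases huw : u = w
              · subst huw; simp [hwL, hwS]
              · simp [huw]
            rw [this]
            refine hconn _ fun u hu => ?_
            rcases hL hu.1 with h | h
            · exact absurd h hu.2
            · exact h.1
          · rw [Set.insert_sdiff_of_notMem _ hwL]
            have hLs : L ⊆ N' \ {s} := fun u hu => by
              rcases hL hu with rfl | h
              · exact absurd hu hwL
              · exact h
            exact (hconn L (hLs.trans Set.sdiff_subset)).insert
              ⟨hs, fun h => (hLs h).2 rfl⟩ hsw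
      · refine ⟨N', hN'S.trans (Set.subset_insert _ _), hN'3, fun L hL => ?_⟩
        rw [Set.insert_sdiff_of_notMem _ fun h => hwN' (hL h)]
        exact (hconn L hL).insert ⟨hs, fun h => hsN' (hL h)⟩ hsw
  obtain ⟨N', hN'V, hN'3, hconn⟩ := key
  obtain ⟨a, b, c, hab, hac, hbc, rfl⟩ := Set.ncard_eq_three.1 hN'3
  have ha : a ∈ V := hN'V (by simp)
  have hb : b ∈ V := hN'V (by simp)
  have hc : c ∈ V := hN'V (by simp)
  have h1 := hconn {a, b} (by intro; simp; tauto)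
  have h2 := hconn {a, c} (by intro; simp; tauto)
  have h3 := hconn {b, c} (by intro; simp; tauto)
  rcases a with a | a <;> rcases b with b | b <;> rcases c with c | c
  · exact .inr ⟨a, b, by simpa using hab, ha, hb, h1⟩
  · exact .inr ⟨a, b, by simpa using hab, ha, hb, h1⟩
  · exact .inr ⟨a, c, by simpa using hac, ha, hc, h2⟩
  · exact .inl ⟨b, c, by simpa using hbc, hb, hc, h3⟩
  · exact .inr ⟨b, c, by simpa using hbc, hb, hc, h3⟩
  · exact .inl ⟨a, c, by simpa using hac, ha, hc, h2⟩
  · exact .inl ⟨a, b, by simpa using hab, ha, hb, h1⟩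
  · exact .inl ⟨a, b, by simpa using hab, ha, hb, h1⟩

/-- Some vertex in `V` has at least three neighbours in `V`. -/
def HasBranch (A : Matrix R C F) (V : Set (R ⊕ C)) : Prop :=
  ∃ v ∈ V, ∃ N ⊆ V, N.ncard = 3 ∧ ∀ w ∈ N, Adj A v w

lemma hasBranch_of_row {i : R} {a b c : C} (hi : Sum.inl i ∈ V) (ha : Sum.inr a ∈ V)
    (hb : Sum.inr b ∈ V) (hc : Sum.inr c ∈ V) (hab : a ≠ b) (hac : a ≠ c) (hbc : b ≠ c)
    (h1 : A i a ≠ 0) (h2 : A i b ≠ 0) (h3 : A i c ≠ 0) : HasBranch A V := by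
  refine ⟨.inl i, hi, {.inr a, .inr b, .inr c}, ?_, ?_, ?_⟩
  · simp [Set.insert_subset_iff, ha, hb, hc]
  · exact Set.ncard_eq_three.2 ⟨_, _, _, by simpa, by simpa, by simpa, rfl⟩
  · simp [Adj, h1, h2, h3]

lemma hasBranch_of_col {j : C} {a b c : R} (hj : Sum.inr j ∈ V) (ha : Sum.inl a ∈ V)
    (hb : Sum.inl b ∈ V) (hc : Sum.inl c ∈ V) (hab : a ≠ b) (hac : a ≠ c) (hbc : b ≠ c)
    (h1 : A a j ≠ 0) (h2 : A b j ≠ 0) (h3 : A c j ≠ 0) : HasBranch A V := by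
  refine ⟨.inr j, hj, {.inl a, .inl b, .inl c}, ?_, ?_, ?_⟩
  · simp [Set.insert_subset_iff, ha, hb, hc]
  · exact Set.ncard_eq_three.2 ⟨_, _, _, by simpa, by simpa, by simpa, rfl⟩
  · simp [Adj, h1, h2, h3]

/-- A connected matrix with at least one nonzero entry has at most two rows and at most two
columns, unless a branch vertex occurs in it after at most one pivot. -/
lemma Conn.subset_or_hasBranch (h : Conn A V) {r₀ : R} {c₀ : C} (hr₀ : Sum.inl r₀ ∈ V)
    (hc₀ : Sum.inr c₀ ∈ V) (h₀ : A r₀ c₀ ≠ 0) :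
    (∃ r r' c c', V ⊆ {.inl r, .inl r', .inr c, .inr c'}) ∨ HasBranch A V ∨
      ∃ r c, Sum.inl r ∈ V ∧ Sum.inr c ∈ V ∧ A r c ≠ 0 ∧ HasBranch (Paper.pivot A r c) V := by
  by_contra! hcon
  obtain ⟨hsmall, hbr, hpbr⟩ := hcon
  have row : ∀ i a b c, Sum.inl i ∈ V → Sum.inr a ∈ V → Sum.inr b ∈ V → Sum.inr c ∈ V →
      A i a ≠ 0 → A i b ≠ 0 → A i c ≠ 0 → a ≠ b → c = a ∨ c = b := by
    intro i a b c hi ha hb hc h1 h2 h3 hab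
    by_contra! hne
    exact hbr (hasBranch_of_row hi ha hb hc hab hne.1.symm hne.2.symm h1 h2 h3)
  have col : ∀ j a b c, Sum.inr j ∈ V → Sum.inl a ∈ V → Sum.inl b ∈ V → Sum.inl c ∈ V →
      A a j ≠ 0 → A b j ≠ 0 → A c j ≠ 0 → a ≠ b → c = a ∨ c = b := by
    intro j a b c hj ha hb hc h1 h2 h3 hab
    by_contra! hne
    exact hbr (hasBranch_of_col hj ha hb hc hab hne.1.symm hne.2.symm h1 h2 h3)
  have fin : ∀ r r' c c', Sum.inl r ∈ V → Sum.inl r' ∈ V → Sum.inr c ∈ V → Sum.inr c' ∈ V →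
      (∀ j, Sum.inr j ∈ V → A r j ≠ 0 → j = c ∨ j = c') →
      (∀ j, Sum.inr j ∈ V → A r' j ≠ 0 → j = c ∨ j = c') →
      (∀ i, Sum.inl i ∈ V → A i c ≠ 0 → i = r ∨ i = r') →
      (∀ i, Sum.inl i ∈ V → A i c' ≠ 0 → i = r ∨ i = r') → False := by
    intro r r' c c' hr hr' hc hc' h1 h2 h3 h4
    refine hsmall r r' c c' (h _ ?_ ⟨.inl r, by simp⟩ ?_)
    · simp [Set.insert_subset_iff, hr, hr', hc, hc']
    · intro i j hi hj hij
      simp only [Set.mem_insert_iff, Set.mem_singleton_iff, Sum.inl.injEq, Sum.inr.injEq,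
        reduceCtorEq, or_false, false_or]
      constructor
      · rintro (rfl | rfl)
        exacts [h1 j hj hij, h2 j hj hij]
      · rintro (rfl | rfl)
        exacts [h3 i hi hij, h4 i hi hij]
  by_cases hbig : ∃ r c r' c', Sum.inl r ∈ V ∧ Sum.inr c ∈ V ∧ Sum.inl r' ∈ V ∧ Sum.inr c' ∈ V ∧
      A r c ≠ 0 ∧ A r c' ≠ 0 ∧ A r' c ≠ 0 ∧ c' ≠ c ∧ r' ≠ r
  · obtain ⟨r, c, r', c', hr, hc, hr', hc', hA, hA', hA'', hcc, hrr⟩ := hbig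
    have hrow : ∀ j, Sum.inr j ∈ V → A r j ≠ 0 → j = c ∨ j = c' := fun j hj hj0 =>
      row r c c' j hr hc hc' hj hA hA' hj0 hcc.symm
    have hcol : ∀ i, Sum.inl i ∈ V → A i c ≠ 0 → i = r ∨ i = r' := fun i hi hi0 =>
      col c r r' i hc hr hr' hi hA hA'' hi0 hrr.symm
    have hp : A r' c' = 0 → Paper.pivot A r c r' c' ≠ 0 := by
      intro h0
      rw [pivot_of_ne _ hrr hcc, h0]
      simp [hA, hA', hA'']
    refine fin r r' c c' hr hr' hc hc' hrow ?_ hcol ?_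
    · intro j hj hj0
      by_contra! hne
      have hrj : A r j = 0 := by
        by_contra h0
        rcases hrow j hj h0 with h | h
        exacts [hne.1 h, hne.2 h]
      by_cases h0 : A r' c' = 0
      · refine hpbr r c hr hc hA (hasBranch_of_row hr' hc hc' hj hcc.symm hne.1.symm hne.2.symm
          ?_ (hp h0) ?_)
        · rwa [pivot_col _ hrr]
        · rwa [pivot_col_of_eq_zero hA hrj]
      · rcases row r' c c' j hr' hc hc' hj hA'' h0 hj0 hcc.symm with h | h
        exacts [hne.1 h, hne.2 h]
    · intro i hi hi0
      by_contra! hne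
      have hic : A i c = 0 := by
        by_contra h0
        rcases hcol i hi h0 with h | h
        exacts [hne.1 h, hne.2 h]
      by_cases h0 : A r' c' = 0
      · refine hpbr r c hr hc hA (hasBranch_of_col hc' hr hr' hi hrr.symm hne.1.symm hne.2.symm
          ?_ (hp h0) ?_)
        · rwa [pivot_row _ _ hcc]
        · rwa [pivot_row_of_eq_zero hA hic]
      · rcases col c' r r' i hc' hr hr' hi hA' h0 hi0 hrr.symm with h | h
        exacts [hne.1 h, hne.2 h]
  · push Not at hbig
    by_cases hc : ∃ c, Sum.inr c ∈ V ∧ A r₀ c ≠ 0 ∧ c ≠ c₀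
    · obtain ⟨c, hc, hc0, hcne⟩ := hc
      refine fin r₀ r₀ c₀ c hr₀ hr₀ hc₀ hc ?_ ?_ ?_ ?_
      · exact fun j hj hj0 => row r₀ c₀ c j hr₀ hc₀ hc hj h₀ hc0 hj0 hcne.symm
      · exact fun j hj hj0 => row r₀ c₀ c j hr₀ hc₀ hc hj h₀ hc0 hj0 hcne.symm
      · exact fun i hi hi0 => .inl (hbig r₀ c₀ i c hr₀ hc₀ hi hc h₀ hc0 hi0 hcne)
      · exact fun i hi hi0 => .inl (hbig r₀ c i c₀ hr₀ hc hi hc₀ hc0 h₀ hi0 hcne.symm)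
    · push Not at hc
      by_cases hr : ∃ r, Sum.inl r ∈ V ∧ A r c₀ ≠ 0 ∧ r ≠ r₀
      · obtain ⟨r, hr, hr0, hrne⟩ := hr
        refine fin r₀ r c₀ c₀ hr₀ hr hc₀ hc₀ ?_ ?_ ?_ ?_
        · exact fun j hj hj0 => .inl (hc j hj hj0)
        · intro j hj hj0
          by_contra! hne
          exact hrne.symm (hbig r c₀ r₀ j hr hc₀ hr₀ hj hr0 hj0 h₀ hne.1)
        · exact fun i hi hi0 => col c₀ r₀ r i hc₀ hr₀ hr hi h₀ hr0 hi0 hrne.symm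
        · exact fun i hi hi0 => col c₀ r₀ r i hc₀ hr₀ hr hi h₀ hr0 hi0 hrne.symm
      · push Not at hr
        refine fin r₀ r₀ c₀ c₀ hr₀ hr₀ hc₀ hc₀ ?_ ?_ ?_ ?_
        · exact fun j hj hj0 => .inl (hc j hj hj0)
        · exact fun j hj hj0 => .inl (hc j hj hj0)
        · exact fun i hi hi0 => .inl (hr i hi hi0)
        · exact fun i hi hi0 => .inl (hr i hi hi0)

end Connectivity

section Walk

variable {R : Type*} {C : Type*} {F : Type*} [Field F]

/-- There is a walk with `n` column steps from row `a` to row `b` in the bipartite graph on `S`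
given by the support of `A`. -/
def Walk (A : Matrix R C F) (S : Set (R ⊕ C)) : ℕ → R → R → Prop
  | 0, a, b => a = b
  | n + 1, a, b => ∃ c r, Sum.inr c ∈ S ∧ Sum.inl r ∈ S ∧ A a c ≠ 0 ∧ A r c ≠ 0 ∧ Walk A S n r b

variable {A : Matrix R C F} {S : Set (R ⊕ C)}

lemma Conn.exists_walk (h : Conn A S) {a b : R} (ha : Sum.inl a ∈ S) (hb : Sum.inl b ∈ S) :
    ∃ n, Walk A S n a b := by
  let U : Set (R ⊕ C) := {u | u ∈ S ∧ Sum.elim (fun r => ∃ n, Walk A S n r b)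
    (fun c => ∃ r n, Sum.inl r ∈ S ∧ A r c ≠ 0 ∧ Walk A S n r b) u}
  have hU := h U (fun u hu => hu.1) ⟨.inl b, hb, 0, rfl⟩ ?_ ha
  · exact hU.2
  · intro i j hi hj hij
    constructor
    · rintro ⟨_, n, hn⟩
      exact ⟨hj, i, n, hi, hij, hn⟩
    · rintro ⟨_, r, n, hr, hrj, hn⟩
      exact ⟨hi, n + 1, j, r, hj, hr, hij, hrj, hn⟩

/-- A walk either survives a pivot, or meets a row which is nonzero in the pivot column. -/
lemma Walk.pivot_or_shortcut {n : ℕ} {a b : R} (h : Walk A S n a b) (ha : Sum.inl a ∈ S) {r' : R}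
    {c' : C} (hA : A r' c' ≠ 0) :
    (∃ m ≤ n, ∃ r, Sum.inl r ∈ S ∧ A r c' ≠ 0 ∧ Walk A S m r b) ∨
      (A a c' = 0 ∧ A b c' = 0 ∧ Walk (pivot A r' c') S n a b) := by
  by_cases h0 : A a c' = 0
  swap
  · exact .inl ⟨n, le_rfl, a, ha, h0, h⟩
  induction n generalizing a with
  | zero =>
    obtain rfl : a = b := h
    exact .inr ⟨h0, h0, rfl⟩
  | succ n ih =>
    obtain ⟨c, r, hc, hr, hac, hrc, hw⟩ := h
    by_cases hr0 : A r c' = 0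
    · rcases ih hw hr hr0 with ⟨m, hm, s, hs⟩ | ⟨_, hb, hw'⟩
      · exact .inl ⟨m, by lia, s, hs⟩
      · exact .inr ⟨h0, hb, c, r, hc, hr, by rwa [pivot_row_of_eq_zero hA h0],
          by rwa [pivot_row_of_eq_zero hA hr0], hw'⟩
    · exact .inl ⟨n, by lia, r, hr, hr0, hw⟩

end Walk

end Paper

namespace Paper

section Unique

variable {R : Type*} {C : Type*} {F : Type*} [Field F]
  {A : Matrix R C F} {T T' : Matrix R C (ZMod 3)} {S : Set (R ⊕ C)}

lemma zmod_three_ratio : ∀ a b x y x' y' : ZMod 3, a ≠ 0 → b ≠ 0 → x ≠ 0 → y ≠ 0 → x' ≠ 0 →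
    y' ≠ 0 → (a * y - x * b = 0 ↔ a * y' - x' * b = 0) → x * y' = x' * y := by
  decide

/-- Two synchronised ternary matrices that agree off the column `z` have proportional entries in
column `z`, at any two rows joined by a walk. -/
lemma col_ratio {z : C} (hz : Sum.inr z ∈ S) {n : ℕ} (h : Sync S A T) (h' : Sync S A T')
    (heq : ∀ i j, Sum.inl i ∈ S → Sum.inr j ∈ S → j ≠ z → T' i j = T i j) {i j : R}
    (hi : Sum.inl i ∈ S) (hj : Sum.inl j ∈ S) (hiz : A i z ≠ 0) (hjz : A j z ≠ 0)
    (hw : Walk A (S \ {Sum.inr z}) n i j) : T i z * T' j z = T' i z * T j z := by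
  induction n using Nat.strong_induction_on generalizing A T T' i with
  | _ n ih =>
  cases n with
  | zero =>
    obtain rfl : i = j := hw
    exact mul_comm _ _
  | succ n =>
  obtain ⟨c, r, ⟨hc, hcz⟩, ⟨hr, -⟩, hic, hrc, hw⟩ := hw
  replace hcz : c ≠ z := by simpa using hcz
  by_cases hrz : A r z = 0
  · cases n with
    | zero =>
      obtain rfl : r = j := hw
      exact absurd hrz hjz
    | succ n =>
    obtain ⟨c₂, r₂, ⟨hc₂, hc₂z⟩, ⟨hr₂, -⟩, hrc₂, hrc₂', hw⟩ := hw
    replace hc₂z : c₂ ≠ z := by simpa using hc₂z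
    by_cases hic₂ : A i c₂ = 0
    swap
    · exact ih (n + 1) (by lia) h h' heq hi hiz hjz
        ⟨c₂, r₂, ⟨hc₂, by simpa⟩, ⟨hr₂, by simp⟩, hic₂, hrc₂', hw⟩
    rcases hw.pivot_or_shortcut ⟨hr₂, by simp⟩ hrc with ⟨m, hm, s, hs, hsc, hw⟩ | ⟨hr₂c, hjc, hw⟩
    · exact ih (m + 1) (by lia) h h' heq hi hiz hjz ⟨c, s, ⟨hc, by simpa⟩, hs, hic, hsc, hw⟩
    have hir : i ≠ r := by rintro rfl; exact hrc₂ hic₂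
    have hcc : c₂ ≠ c := by rintro rfl; exact hic hic₂
    have hTrc := (h.entry_ne hr hc).1 hrc
    have hTrc' := (h'.entry_ne hr hc).1 hrc
    have hTrz := (h.entry hr hz).1 hrz
    have hTrz' := (h'.entry hr hz).1 hrz
    have := ih (n + 1) (by lia) (h.pivot hr hc hrc) (h'.pivot hr hc hrc) ?_ hi ?_ ?_
      ⟨c₂, r₂, ⟨hc₂, by simpa⟩, ⟨hr₂, by simp⟩, ?_, ?_, hw⟩
    · simpa only [pivot_col_of_eq_zero hTrc hTrz, pivot_col_of_eq_zero hTrc' hTrz'] using this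
    · intro i' j' hi' hj' hj'z
      simp only [pivot, heq _ _ hr hc hcz, heq _ _ hr hj' hj'z, heq _ _ hi' hc hcz,
        heq _ _ hi' hj' hj'z]
    · rwa [pivot_col_of_eq_zero hrc hrz]
    · rwa [pivot_col_of_eq_zero hrc hrz]
    · rw [pivot_of_ne _ hir hcc, hic₂]
      simp [hic, hrc, hrc₂]
    · rwa [pivot_row_of_eq_zero hrc hr₂c]
  · have h1 := ih n (by lia) h h' heq hr hrz hjz hw
    have e1 := h.two hi hr hc hz
    have e2 := h'.two hi hr hc hz
    rw [heq _ _ hi hc hcz, heq _ _ hr hc hcz] at e2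
    have h2 := zmod_three_ratio _ _ _ _ _ _ ((h.entry_ne hi hc).1 hic) ((h.entry_ne hr hc).1 hrc)
      ((h.entry_ne hi hz).1 hiz) ((h.entry_ne hr hz).1 hrz) ((h'.entry_ne hi hz).1 hiz)
      ((h'.entry_ne hr hz).1 hrz) (e1.symm.trans e2)
    have h3 := (h.entry_ne hr hz).1 hrz
    have h4 := (h'.entry_ne hr hz).1 hrz
    have : T r z * T' r z * (T i z * T' j z - T' i z * T j z) = 0 := by
      linear_combination T i z * T' r z * h1 + T' r z * T j z * h2
    rcases mul_eq_zero.1 this with h5 | h5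
    · exact absurd h5 (mul_ne_zero h3 h4)
    · exact sub_eq_zero.1 h5

/-- `T'` is obtained from `T` on `S` by rescaling rows and columns. -/
def Scaled {G : Type*} [Field G] (S : Set (R ⊕ C)) (T T' : Matrix R C G) : Prop :=
  ∃ (d : R → G) (e : C → G), (∀ i, d i ≠ 0) ∧ (∀ j, e j ≠ 0) ∧
    ∀ i j, Sum.inl i ∈ S → Sum.inr j ∈ S → T' i j = d i * T i j * e j

lemma Scaled.transpose (h : Scaled S T T') :
    Scaled (Sum.swap ⁻¹' S) T.transpose T'.transpose := by
  obtain ⟨d, e, hd, he, h⟩ := h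
  refine ⟨e, d, he, hd, fun i j hi hj => ?_⟩
  rw [Matrix.transpose_apply, Matrix.transpose_apply, h j i hj hi]
  ring

lemma Scaled.insert_col (hs : Scaled S T T') (hS : Conn A S) {z : C} (hz : Sum.inr z ∉ S)
    (h : Sync (Insert.insert (Sum.inr z) S) A T) (h' : Sync (Insert.insert (Sum.inr z) S) A T') :
    Scaled (Insert.insert (Sum.inr z) S) T T' := by
  classical
  obtain ⟨d, e, hd, he, hde⟩ := hs
  have hzS : Sum.inr z ∈ Insert.insert (Sum.inr z) S := Set.mem_insert _ _
  have hsub : S ⊆ Insert.insert (Sum.inr z) S := Set.subset_insert _ _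
  by_cases h0 : ∃ i, Sum.inl i ∈ S ∧ A i z ≠ 0
  · obtain ⟨i₀, hi₀, hA₀⟩ := h0
    have hT₀ := (h.entry_ne (hsub hi₀) hzS).1 hA₀
    have hT₀' := (h'.entry_ne (hsub hi₀) hzS).1 hA₀
    refine ⟨d, Function.update e z (T' i₀ z / (d i₀ * T i₀ z)), hd, fun j => ?_,
      fun i j hi hj => ?_⟩
    · by_cases hj : j = z
      · subst hj
        simp [hT₀, hT₀', hd]
      · simp [hj, he]
    · replace hi : Sum.inl i ∈ S := by simpa using hi
      by_cases hjz : j = z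
      · subst hjz
        rw [Function.update_self]
        by_cases hA : A i j = 0
        · simp [(h.entry (hsub hi) hzS).1 hA, (h'.entry (hsub hi) hzS).1 hA]
        · obtain ⟨n, hn⟩ := hS.exists_walk hi hi₀
          have := col_ratio hzS (h.scale hd he) h' (fun i' j' hi' hj' hne => ?_) (hsub hi)
            (hsub hi₀) hA hA₀ (n := n) (by simpa [Set.insert_sdiff_self_of_notMem hz] using hn)
          · simp only [Matrix.of_apply] at this
            have hdi := hd i₀
            have hej := he j
            field_simp
            apply mul_right_cancel₀ hej
            linear_combination -this
          · exact hde _ _ (by simpa using hi') (by simpa [hne] using hj')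
      · rw [Function.update_of_ne hjz]
        exact hde _ _ hi (by simpa [hjz] using hj)
  · push Not at h0
    refine ⟨d, e, hd, he, fun i j hi hj => ?_⟩
    have hi' : Sum.inl i ∈ S := by simpa using hi
    rcases hj with hj | hj
    · obtain rfl : j = z := by simpa using hj
      simp [(h.entry hi hzS).1 (h0 i hi'), (h'.entry hi hzS).1 (h0 i hi')]
    · exact hde i j hi' hj

lemma swap_preimage_insert (v : R ⊕ C) :
    Sum.swap ⁻¹' (Insert.insert v S) = Insert.insert v.swap (Sum.swap ⁻¹' S) := by
  ext u
  simp only [Set.mem_preimage, Set.mem_insert_iff]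
  rw [← Sum.swap_rightInverse.injective.eq_iff (a := u.swap) (b := v), Sum.swap_swap]

lemma Scaled.insert (hs : Scaled S T T') (hS : Conn A S) {w : R ⊕ C} (hw : w ∉ S)
    (h : Sync (Insert.insert w S) A T) (h' : Sync (Insert.insert w S) A T') :
    Scaled (Insert.insert w S) T T' := by
  rcases w with z | z
  · have h1 := h.transpose
    have h2 := h'.transpose
    rw [swap_preimage_insert] at h1 h2
    have := (hs.transpose.insert_col hS.transpose (by simpa using hw) h1 h2).transpose
    rw [swap_preimage_insert] at this
    have hswap : Sum.swap ⁻¹' (Sum.swap ⁻¹' S) = S := by ext; simp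
    simpa [hswap] using this
  · exact hs.insert_col hS hw h h'

/-- A ternary matrix synchronised with a connected matrix is unique up to scaling. -/
lemma Conn.scaled (hA : Conn A S) (hS : S.Finite) (h : Sync S A T) (h' : Sync S A T') :
    Scaled S T T' := by
  rcases S.eq_empty_or_nonempty with rfl | ⟨v, hv⟩
  · exact ⟨1, 1, by simp, by simp, by simp⟩
  · have hv' : ({v} : Set (R ⊕ C)) ⊆ S := by simpa
    refine (hA.grow hS (fun U => Conn A U ∧ Scaled U T T') hv' (Set.singleton_nonempty v)
      ⟨conn_singleton v, 1, 1, by simp, by simp, ?_⟩ ?_).2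
    · rintro i j rfl hj
      simp at hj
    · rintro U hU ⟨hcU, hsU⟩ s hs w hw hwU hsw
      have hsub := Set.insert_subset hw hU
      exact ⟨hcU.insert hs hsw, hsU.insert hcU hwU (h.mono hsub) (h'.mono hsub)⟩

end Unique

end Paper

namespace Paper

section Algebra

lemma minors_of_three_columns {F : Type*} [Field F] {c c' x x' y y' : F} (hc : c ≠ 0)
    (hx : x ≠ 0) (hy : y ≠ 0)
    (h : ¬(c * x' - x * c' ≠ 0 ∧ c * y' - y * c' ≠ 0 ∧ x * y' - y * x' ≠ 0)) :
    x * y' - y * x' = 0 ↔ (c * x' - x * c' = 0 ↔ c * y' - y * c' = 0) := by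
  have e : c * (x * y' - y * x') = x * (c * y' - y * c') - y * (c * x' - x * c') := by ring
  by_cases h1 : c * x' - x * c' = 0 <;> by_cases h2 : c * y' - y * c' = 0 <;> simp_all
  all_goals
    intro h3
    simp_all

lemma zmod_three_minors {c c' x x' y y' : ZMod 3} (hc : c ≠ 0) (hc' : c' ≠ 0) (hx : x ≠ 0)
    (hx' : x' ≠ 0) (hy : y ≠ 0) (hy' : y' ≠ 0) :
    ¬(c * x' - x * c' ≠ 0 ∧ c * y' - y * c' ≠ 0 ∧ x * y' - y * x' ≠ 0) := by
  have hz : ∀ z : ZMod 3, z ≠ 0 → z = 1 ∨ z = 2 := by decide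
  rcases hz c hc with rfl | rfl <;> rcases hz c' hc' with rfl | rfl <;>
  rcases hz x hx with rfl | rfl <;> rcases hz x' hx' with rfl | rfl <;>
  rcases hz y hy with rfl | rfl <;> rcases hz y' hy' with rfl | rfl <;> decide

/-- The `3 × 2` matrix with the given columns has all entries and all minors nonzero. -/
def Generic {F : Type*} [Field F] (x₁ x₂ x₃ y₁ y₂ y₃ : F) : Prop :=
  (x₁ ≠ 0 ∧ x₂ ≠ 0 ∧ x₃ ≠ 0) ∧ (y₁ ≠ 0 ∧ y₂ ≠ 0 ∧ y₃ ≠ 0) ∧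
    x₁ * y₂ - x₂ * y₁ ≠ 0 ∧ x₁ * y₃ - x₃ * y₁ ≠ 0 ∧ x₂ * y₃ - x₃ * y₂ ≠ 0

lemma three_rows_case_analysis {F : Type*} [Field F] (two : (2 : F) ≠ 0) {p q c d : F}
    {P Q C D : ZMod 3}
    (hc : c ≠ 0) (hd : d ≠ 0) (hC : C ≠ 0) (hD : D ≠ 0)
    (h1 : p = 0 ↔ P = 0) (h2 : q = 0 ↔ Q = 0) (h3 : p = 1 ↔ P = 1) (h4 : q = 1 ↔ Q = 1)
    (h5 : c = p ↔ C = P) (h6 : d = q ↔ D = Q) (h7 : c - p + 1 = 0 ↔ C - P + 1 = 0)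
    (h8 : d - q + 1 = 0 ↔ D - Q + 1 = 0) (h9 : p = q ↔ P = Q)
    (h10 : p * d = q * c ↔ P * D = Q * C)
    (h11 : p * d - q * c - (d - c) = 0 ↔ P * D - Q * C - (D - C) = 0)
    (h12 : c - d + (q - p) = 0 ↔ C - D + (Q - P) = 0)
    (u1 : p ≠ 0 → q ≠ 0 → p ≠ q → p * d ≠ q * c → c = d)
    (u2 : p - 1 - c ≠ 0 → q - 1 - d ≠ 0 → p - 1 - c ≠ q - 1 - d →
      (p - 1 - c) * d ≠ (q - 1 - d) * c → c = d)
    (u3 : p - c ≠ 0 → q - d ≠ 0 → p - c ≠ q - d → (p - c) * d ≠ (q - d) * c → c = d)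
    (u4 : p - 1 ≠ 0 → q - 1 ≠ 0 → p - 1 ≠ q - 1 → (p - 1) * d ≠ (q - 1) * c → c = d) :
    c = d ↔ C = D := by
  have hz : ∀ z : ZMod 3, z = 0 ∨ z = 1 ∨ z = 2 := by decide
  rcases hz P with rfl | rfl | rfl <;> rcases hz Q with rfl | rfl | rfl <;>
  rcases hz C with rfl | rfl | rfl <;> rcases hz D with rfl | rfl | rfl <;>
  first | exact absurd rfl hC | exact absurd rfl hD | skip
  all_goals
    simp (decide := true) only [iff_true, iff_false] at h1 h2 h3 h4 h5 h6 h7 h8 h9 h10 h11 h12 ⊢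
  all_goals clear hz hC hD
  all_goals first
    | grind only
    | by_contra h
      first
      | exact h (u2 (by grind only) (by grind only) (by grind only) (by grind only))
      | exact h (u3 (by grind only) (by grind only) (by grind only) (by grind only))
      | exact h (u4 (by grind only) (by grind only) (by grind only) (by grind only))

/-- Relations between the entries of a `3 × 4` matrix with rows `(a₁, 0, x₁, y₁)`,
`(a₂, b₂, x₂, y₂)`, `(0, b₃, x₃, y₃)`, after rescaling to `(1, 0, 1, 1)`, `(1, 1, p, q)`,
`(0, 1, c, d)`. -/
lemma normalize_column {F : Type*} [Field F] {a₁ a₂ b₂ b₃ x₁ x₂ x₃ : F} (ha₁ : a₁ ≠ 0)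
    (ha₂ : a₂ ≠ 0) (hb₂ : b₂ ≠ 0) (hb₃ : b₃ ≠ 0) (hx₁ : x₁ ≠ 0) (hx₃ : x₃ ≠ 0) {p c : F}
    (hp : p = a₁ * x₂ / (a₂ * x₁)) (hc : c = a₁ * b₂ * x₃ / (a₂ * b₃ * x₁)) :
    c ≠ 0 ∧ (p = 0 ↔ x₂ = 0) ∧ (p = 1 ↔ a₁ * x₂ - x₁ * a₂ = 0) ∧
      (c = p ↔ b₂ * x₃ - x₂ * b₃ = 0) ∧
      (c - p + 1 = 0 ↔ -(a₁ * b₂ / a₂) * x₃ - (x₁ - a₁ * x₂ / a₂) * b₃ = 0) := by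
  refine ⟨?_, ?_, ?_, ?_, ?_⟩
  · rw [hc]; simp [*]
  · rw [hp]; simp [ha₁, ha₂, hx₁]
  · rw [hp, div_eq_one_iff_eq (by simp [*]), sub_eq_zero, mul_comm a₂]
  · have : c - p = (b₂ * x₃ - x₂ * b₃) * (a₁ / (a₂ * b₃ * x₁)) := by
      rw [hc, hp]; field_simp
    rw [← sub_eq_zero, this, mul_eq_zero, or_iff_left (by simp [*])]
  · have : c - p + 1 = (-(a₁ * b₂ / a₂) * x₃ - (x₁ - a₁ * x₂ / a₂) * b₃) * (-(1 / (b₃ * x₁))) := by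
      rw [hc, hp]; field_simp; ring
    rw [this, mul_eq_zero, or_iff_left (neg_ne_zero.2 (by simp [*]))]

lemma normalize_pair {F : Type*} [Field F] {a₁ a₂ b₂ b₃ x₁ x₂ x₃ y₁ y₂ y₃ : F} (ha₁ : a₁ ≠ 0)
    (ha₂ : a₂ ≠ 0) (hb₂ : b₂ ≠ 0) (hb₃ : b₃ ≠ 0) (hx₁ : x₁ ≠ 0) (hy₁ : y₁ ≠ 0) {p c q d : F}
    (hp : p = a₁ * x₂ / (a₂ * x₁)) (hc : c = a₁ * b₂ * x₃ / (a₂ * b₃ * x₁))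
    (hq : q = a₁ * y₂ / (a₂ * y₁)) (hd : d = a₁ * b₂ * y₃ / (a₂ * b₃ * y₁)) :
    (p = q ↔ x₁ * y₂ - y₁ * x₂ = 0) ∧ (p * d = q * c ↔ x₂ * y₃ - y₂ * x₃ = 0) ∧
      (p * d - q * c - (d - c) = 0 ↔
        (x₁ - a₁ * x₂ / a₂) * y₃ - (y₁ - a₁ * y₂ / a₂) * x₃ = 0) ∧
      (c - d + (q - p) = 0 ↔ x₁ * (y₃ - b₃ * y₂ / b₂) - y₁ * (x₃ - b₃ * x₂ / b₂) = 0) ∧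
      (c = d ↔ x₁ * y₃ - y₁ * x₃ = 0) := by
  refine ⟨?_, ?_, ?_, ?_, ?_⟩
  · have : p - q = (x₁ * y₂ - y₁ * x₂) * (-(a₁ / (a₂ * x₁ * y₁))) := by
      rw [hp, hq]; field_simp; ring
    rw [← sub_eq_zero, this, mul_eq_zero, or_iff_left (neg_ne_zero.2 (by simp [*]))]
  · have : p * d - q * c = (x₂ * y₃ - y₂ * x₃) * (a₁ ^ 2 * b₂ / (a₂ ^ 2 * b₃ * x₁ * y₁)) := by
      rw [hp, hq, hc, hd]; field_simp
    rw [← sub_eq_zero, this, mul_eq_zero, or_iff_left (by simp [*])]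
  · have : p * d - q * c - (d - c) = ((x₁ - a₁ * x₂ / a₂) * y₃ - (y₁ - a₁ * y₂ / a₂) * x₃) *
        (-(a₁ * b₂ / (a₂ * b₃ * x₁ * y₁))) := by
      rw [hp, hq, hc, hd]; field_simp; ring
    rw [this, mul_eq_zero, or_iff_left (neg_ne_zero.2 (by simp [*]))]
  · have : c - d + (q - p) = (x₁ * (y₃ - b₃ * y₂ / b₂) - y₁ * (x₃ - b₃ * x₂ / b₂)) *
        (-(a₁ * b₂ / (a₂ * b₃ * x₁ * y₁))) := by
      rw [hp, hq, hc, hd]; field_simp; ring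
    rw [this, mul_eq_zero, or_iff_left (neg_ne_zero.2 (by simp [*]))]
  · have : c - d = (x₁ * y₃ - y₁ * x₃) * (-(a₁ * b₂ / (a₂ * b₃ * x₁ * y₁))) := by
      rw [hc, hd]; field_simp; ring
    rw [← sub_eq_zero, this, mul_eq_zero, or_iff_left (neg_ne_zero.2 (by simp [*]))]

lemma normalize_generic {F : Type*} [Field F] {a₁ a₂ b₂ b₃ x₁ x₂ x₃ y₁ y₂ y₃ : F} (ha₁ : a₁ ≠ 0)
    (ha₂ : a₂ ≠ 0) (hb₂ : b₂ ≠ 0) (hb₃ : b₃ ≠ 0) (hx₁ : x₁ ≠ 0) (hx₃ : x₃ ≠ 0) (hy₁ : y₁ ≠ 0)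
    (hy₃ : y₃ ≠ 0) {p c q d : F}
    (hp : p = a₁ * x₂ / (a₂ * x₁)) (hc : c = a₁ * b₂ * x₃ / (a₂ * b₃ * x₁))
    (hq : q = a₁ * y₂ / (a₂ * y₁)) (hd : d = a₁ * b₂ * y₃ / (a₂ * b₃ * y₁))
    (h : ¬ Generic x₁ x₂ x₃ y₁ y₂ y₃) :
    p ≠ 0 → q ≠ 0 → p ≠ q → p * d ≠ q * c → c = d := by
  obtain ⟨h1, h2, -, -, h3⟩ := normalize_pair ha₁ ha₂ hb₂ hb₃ hx₁ hy₁ hp hc hq hd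
  intro h4 h5 h6 h7
  by_contra h8
  have hx₂ : x₂ ≠ 0 := by rintro rfl; simp [hp] at h4
  have hy₂ : y₂ ≠ 0 := by rintro rfl; simp [hq] at h5
  refine h ⟨⟨hx₁, hx₂, hx₃⟩, ⟨hy₁, hy₂, hy₃⟩, ?_, ?_, ?_⟩
  · simpa only [mul_comm y₁] using h1.not.1 h6
  · simpa only [mul_comm y₁] using h3.not.1 h8
  · simpa only [mul_comm y₂] using h2.not.1 h7

lemma three_rows_minor {F : Type*} [Field F] (two : (2 : F) ≠ 0)
    {a₁ a₂ b₂ b₃ x₁ x₂ x₃ y₁ y₂ y₃ : F} {A₁ A₂ B₂ B₃ X₁ X₂ X₃ Y₁ Y₂ Y₃ : ZMod 3}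
    (ha₁ : a₁ ≠ 0) (ha₂ : a₂ ≠ 0) (hb₂ : b₂ ≠ 0) (hb₃ : b₃ ≠ 0) (hx₁ : x₁ ≠ 0) (hx₃ : x₃ ≠ 0)
    (hy₁ : y₁ ≠ 0) (hy₃ : y₃ ≠ 0)
    (hA₁ : A₁ ≠ 0) (hA₂ : A₂ ≠ 0) (hB₂ : B₂ ≠ 0) (hB₃ : B₃ ≠ 0) (hX₁ : X₁ ≠ 0) (hX₃ : X₃ ≠ 0)
    (hY₁ : Y₁ ≠ 0) (hY₃ : Y₃ ≠ 0)
    (hx₂ : x₂ = 0 ↔ X₂ = 0) (hy₂ : y₂ = 0 ↔ Y₂ = 0)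
    (hax : a₁ * x₂ - x₁ * a₂ = 0 ↔ A₁ * X₂ - X₁ * A₂ = 0)
    (hay : a₁ * y₂ - y₁ * a₂ = 0 ↔ A₁ * Y₂ - Y₁ * A₂ = 0)
    (hbx : b₂ * x₃ - x₂ * b₃ = 0 ↔ B₂ * X₃ - X₂ * B₃ = 0)
    (hby : b₂ * y₃ - y₂ * b₃ = 0 ↔ B₂ * Y₃ - Y₂ * B₃ = 0)
    (habx : -(a₁ * b₂ / a₂) * x₃ - (x₁ - a₁ * x₂ / a₂) * b₃ = 0 ↔
      -(A₁ * B₂ / A₂) * X₃ - (X₁ - A₁ * X₂ / A₂) * B₃ = 0)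
    (haby : -(a₁ * b₂ / a₂) * y₃ - (y₁ - a₁ * y₂ / a₂) * b₃ = 0 ↔
      -(A₁ * B₂ / A₂) * Y₃ - (Y₁ - A₁ * Y₂ / A₂) * B₃ = 0)
    (h₁₂ : x₁ * y₂ - y₁ * x₂ = 0 ↔ X₁ * Y₂ - Y₁ * X₂ = 0)
    (h₂₃ : x₂ * y₃ - y₂ * x₃ = 0 ↔ X₂ * Y₃ - Y₂ * X₃ = 0)
    (ha : (x₁ - a₁ * x₂ / a₂) * y₃ - (y₁ - a₁ * y₂ / a₂) * x₃ = 0 ↔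
      (X₁ - A₁ * X₂ / A₂) * Y₃ - (Y₁ - A₁ * Y₂ / A₂) * X₃ = 0)
    (hb : x₁ * (y₃ - b₃ * y₂ / b₂) - y₁ * (x₃ - b₃ * x₂ / b₂) = 0 ↔
      X₁ * (Y₃ - B₃ * Y₂ / B₂) - Y₁ * (X₃ - B₃ * X₂ / B₂) = 0)
    (u : ¬ Generic x₁ x₂ x₃ y₁ y₂ y₃)
    (ua : ¬ Generic x₁ (x₂ - a₂ * x₁ / a₁) x₃ y₁ (y₂ - a₂ * y₁ / a₁) y₃)
    (ub : ¬ Generic x₁ (x₂ - b₂ * x₃ / b₃) x₃ y₁ (y₂ - b₂ * y₃ / b₃) y₃)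
    (uab : ¬ Generic x₁ (x₂ - a₂ * x₁ / a₁ - b₂ * x₃ / b₃) x₃
      y₁ (y₂ - a₂ * y₁ / a₁ - b₂ * y₃ / b₃) y₃) :
    x₁ * y₃ - y₁ * x₃ = 0 ↔ X₁ * Y₃ - Y₁ * X₃ = 0 := by
  obtain ⟨p, hp⟩ : ∃ p, p = a₁ * x₂ / (a₂ * x₁) := ⟨_, rfl⟩
  obtain ⟨q, hq⟩ : ∃ q, q = a₁ * y₂ / (a₂ * y₁) := ⟨_, rfl⟩
  obtain ⟨c, hc⟩ : ∃ c, c = a₁ * b₂ * x₃ / (a₂ * b₃ * x₁) := ⟨_, rfl⟩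
  obtain ⟨d, hd⟩ : ∃ d, d = a₁ * b₂ * y₃ / (a₂ * b₃ * y₁) := ⟨_, rfl⟩
  obtain ⟨P, hP⟩ : ∃ P, P = A₁ * X₂ / (A₂ * X₁) := ⟨_, rfl⟩
  obtain ⟨Q, hQ⟩ : ∃ Q, Q = A₁ * Y₂ / (A₂ * Y₁) := ⟨_, rfl⟩
  obtain ⟨C, hC⟩ : ∃ C, C = A₁ * B₂ * X₃ / (A₂ * B₃ * X₁) := ⟨_, rfl⟩
  obtain ⟨D, hD⟩ : ∃ D, D = A₁ * B₂ * Y₃ / (A₂ * B₃ * Y₁) := ⟨_, rfl⟩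
  obtain ⟨x0, x1, x2, x3, x4⟩ := normalize_column ha₁ ha₂ hb₂ hb₃ hx₁ hx₃ hp hc
  obtain ⟨y0, y1, y2, y3, y4⟩ := normalize_column ha₁ ha₂ hb₂ hb₃ hy₁ hy₃ hq hd
  obtain ⟨X0, X1, X2, X3, X4⟩ := normalize_column hA₁ hA₂ hB₂ hB₃ hX₁ hX₃ hP hC
  obtain ⟨Y0, Y1, Y2, Y3, Y4⟩ := normalize_column hA₁ hA₂ hB₂ hB₃ hY₁ hY₃ hQ hD
  obtain ⟨z1, z2, z3, z4, z5⟩ := normalize_pair ha₁ ha₂ hb₂ hb₃ hx₁ hy₁ hp hc hq hd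
  obtain ⟨Z1, Z2, Z3, Z4, Z5⟩ := normalize_pair hA₁ hA₂ hB₂ hB₃ hX₁ hY₁ hP hC hQ hD
  rw [← z5, ← Z5]
  exact three_rows_case_analysis two x0 y0 X0 Y0 (x1.trans (hx₂.trans X1.symm))
    (y1.trans (hy₂.trans Y1.symm)) (x2.trans (hax.trans X2.symm)) (y2.trans (hay.trans Y2.symm))
    (x3.trans (hbx.trans X3.symm)) (y3.trans (hby.trans Y3.symm)) (x4.trans (habx.trans X4.symm))
    (y4.trans (haby.trans Y4.symm)) (z1.trans (h₁₂.trans Z1.symm)) (z2.trans (h₂₃.trans Z2.symm))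
    (z3.trans (ha.trans Z3.symm)) (z4.trans (hb.trans Z4.symm))
    (normalize_generic ha₁ ha₂ hb₂ hb₃ hx₁ hx₃ hy₁ hy₃ hp hc hq hd u)
    (normalize_generic ha₁ ha₂ hb₂ hb₃ hx₁ hx₃ hy₁ hy₃ (by rw [hp, hc]; field_simp) hc
      (by rw [hq, hd]; field_simp) hd uab)
    (normalize_generic ha₁ ha₂ hb₂ hb₃ hx₁ hx₃ hy₁ hy₃ (by rw [hp, hc]; field_simp) hc
      (by rw [hq, hd]; field_simp) hd ub)
    (normalize_generic ha₁ ha₂ hb₂ hb₃ hx₁ hx₃ hy₁ hy₃ (by rw [hp]; field_simp) hc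
      (by rw [hq]; field_simp) hd ua)

end Algebra
end Paper

namespace Paper

section Glue

variable {R : Type*} {C : Type*} {F : Type*} [Field F]
  {A A' : Matrix R C F} {T : Matrix R C (ZMod 3)} {S : Set (R ⊕ C)}

/-- `A'` is obtained from `A` by a pivot on a nonzero entry of `S`. -/
def PivotStep (S : Set (R ⊕ C)) (A A' : Matrix R C F) : Prop :=
  ∃ r c, Sum.inl r ∈ S ∧ Sum.inr c ∈ S ∧ A r c ≠ 0 ∧ A' = pivot A r c

/-- No sequence of pivots in `S` leads to a `2 × 3` or a `3 × 2` submatrix all of whose entries and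
minors are nonzero. -/
def NoGeneric (S : Set (R ⊕ C)) (A : Matrix R C F) : Prop :=
  ∀ A', Relation.ReflTransGen (PivotStep S) A A' →
    (∀ i j a b c, Sum.inl i ∈ S → Sum.inl j ∈ S → Sum.inr a ∈ S → Sum.inr b ∈ S → Sum.inr c ∈ S →
      ¬ Generic (A' i a) (A' i b) (A' i c) (A' j a) (A' j b) (A' j c)) ∧
    (∀ i j k a b, Sum.inl i ∈ S → Sum.inl j ∈ S → Sum.inl k ∈ S → Sum.inr a ∈ S → Sum.inr b ∈ S →
      ¬ Generic (A' i a) (A' j a) (A' k a) (A' i b) (A' j b) (A' k b))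

lemma NoGeneric.pivot (h : NoGeneric S A) {r : R} {c : C} (hr : Sum.inl r ∈ S)
    (hc : Sum.inr c ∈ S) (hA : A r c ≠ 0) : NoGeneric S (pivot A r c) :=
  fun A' hA' => h A' (hA'.head ⟨r, c, hr, hc, hA, rfl⟩)

lemma NoGeneric.mono (h : NoGeneric S A) {S' : Set (R ⊕ C)} (hS : S' ⊆ S) : NoGeneric S' A := by
  intro A' hA'
  have := h A' (Relation.ReflTransGen.mono
    (fun B B' ⟨r, c, hr, hc, hB⟩ => ⟨r, c, hS hr, hS hc, hB⟩) _ _ hA')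
  exact ⟨fun i j a b c hi hj ha hb hc => this.1 i j a b c (hS hi) (hS hj) (hS ha) (hS hb) (hS hc),
    fun i j k a b hi hj hk ha hb => this.2 i j k a b (hS hi) (hS hj) (hS hk) (hS ha) (hS hb)⟩

lemma NoGeneric.transpose (h : NoGeneric S A) : NoGeneric (Sum.swap ⁻¹' S) A.transpose := by
  intro A' hA'
  have h1 : Relation.ReflTransGen (PivotStep S) A A'.transpose := by
    refine Relation.ReflTransGen.lift Matrix.transpose ?_ A.transpose A' hA'
    rintro B B' ⟨r, c, hr, hc, hB, rfl⟩
    exact ⟨c, r, hc, hr, hB, pivot_transpose _ _ _⟩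
  have h2 := h _ h1
  exact ⟨fun i j a b c hi hj ha hb hc => h2.2 a b c i j ha hb hc hi hj,
    fun i j k a b hi hj hk ha hb => h2.1 a b i j k ha hb hi hj hk⟩

/-- The hypotheses under which synchronisation off the column `x` and off the column `y` can be
glued together. -/
structure Glue (S : Set (R ⊕ C)) (x y : C) (A : Matrix R C F) (T : Matrix R C (ZMod 3)) :
    Prop where
  ne : x ≠ y
  noGeneric : NoGeneric S A
  off_left : Sync (S \ {Sum.inr x}) A T
  off_right : Sync (S \ {Sum.inr y}) A T

namespace Glue

variable {x y : C}

lemma pivot (h : Glue S x y A T) {r : R} {c : C} (hr : Sum.inl r ∈ S) (hc : Sum.inr c ∈ S)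
    (hcx : c ≠ x) (hcy : c ≠ y) (hA : A r c ≠ 0) :
    Glue S x y (Paper.pivot A r c) (Paper.pivot T r c) where
  ne := h.ne
  noGeneric := h.noGeneric.pivot hr hc hA
  off_left := h.off_left.pivot (by simpa) (by simp [hc, hcx]) hA
  off_right := h.off_right.pivot (by simpa) (by simp [hc, hcy]) hA

lemma entry (h : Glue S x y A T) {i : R} {j : C} (hi : Sum.inl i ∈ S) (hj : Sum.inr j ∈ S) :
    A i j = 0 ↔ T i j = 0 := by
  by_cases hjx : j = x
  · exact h.off_right.entry (by simpa) ⟨hj, by simp [hjx, h.ne]⟩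
  · exact h.off_left.entry (by simpa) (by simp [hj, hjx])

lemma minor_of_zero (h : Glue S x y A T) {i i' : R} {j j' : C} (hi : Sum.inl i ∈ S)
    (hi' : Sum.inl i' ∈ S) (hj : Sum.inr j ∈ S) (hj' : Sum.inr j' ∈ S)
    (h0 : A i j = 0 ∨ A i' j' = 0 ∨ A i j' = 0 ∨ A i' j = 0) :
    A i j * A i' j' - A i j' * A i' j = 0 ↔ T i j * T i' j' - T i j' * T i' j = 0 := by
  have e1 := h.entry hi hj
  have e2 := h.entry hi hj'
  have e3 := h.entry hi' hj
  have e4 := h.entry hi' hj'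
  rcases h0 with h0 | h0 | h0 | h0
  · simp [h0, e1.1 h0, e2, e3]
  · simp [h0, e4.1 h0, e2, e3]
  · simp [h0, e2.1 h0, e1, e4]
  · simp [h0, e3.1 h0, e1, e4]

lemma minor_of_common (h : Glue S x y A T) (hx : Sum.inr x ∈ S) (hy : Sum.inr y ∈ S) {i j : R}
    {c : C} (hi : Sum.inl i ∈ S) (hj : Sum.inl j ∈ S) (hc : Sum.inr c ∈ S) (hcx : c ≠ x)
    (hcy : c ≠ y) (hic : A i c ≠ 0) (hjc : A j c ≠ 0) :
    A i x * A j y - A i y * A j x = 0 ↔ T i x * T j y - T i y * T j x = 0 := by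
  by_cases h0 : A i x = 0 ∨ A j y = 0 ∨ A i y = 0 ∨ A j x = 0
  · exact h.minor_of_zero hi hj hx hy h0
  push Not at h0
  obtain ⟨hix, hjy, hiy, hjx⟩ := h0
  have hyx := h.ne.symm
  rw [minors_of_three_columns hic hix hiy, minors_of_three_columns
    ((h.entry hi hc).not.1 hic) ((h.entry hi hx).not.1 hix) ((h.entry hi hy).not.1 hiy),
    h.off_right.two (by simpa) (by simpa) (by simp [hc, hcy]) (by simp [hx, h.ne]),
    h.off_left.two (by simpa) (by simpa) (by simp [hc, hcx]) (by simp [hy, hyx])]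
  · exact zmod_three_minors ((h.entry hi hc).not.1 hic) ((h.entry hj hc).not.1 hjc)
      ((h.entry hi hx).not.1 hix) ((h.entry hj hx).not.1 hjx) ((h.entry hi hy).not.1 hiy)
      ((h.entry hj hy).not.1 hjy)
  · rintro ⟨h1, h2, h3⟩
    refine (h.noGeneric A .refl).1 i j c x y hi hj hc hx hy
      ⟨⟨hic, hix, hiy⟩, ⟨hjc, hjx, hjy⟩, h1, h2, h3⟩

lemma minor_of_path (two : (2 : F) ≠ 0) (h : Glue S x y A T) (hx : Sum.inr x ∈ S)
    (hy : Sum.inr y ∈ S) {i r j : R} {c c' : C} (hi : Sum.inl i ∈ S) (hr : Sum.inl r ∈ S)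
    (hj : Sum.inl j ∈ S) (hc : Sum.inr c ∈ S) (hcx : c ≠ x) (hcy : c ≠ y) (hc' : Sum.inr c' ∈ S)
    (hcx' : c' ≠ x) (hcy' : c' ≠ y) (hic : A i c ≠ 0) (hrc : A r c ≠ 0) (hrc' : A r c' ≠ 0)
    (hjc' : A j c' ≠ 0) :
    A i x * A j y - A i y * A j x = 0 ↔ T i x * T j y - T i y * T j x = 0 := by
  by_cases hic' : A i c' = 0
  swap
  · exact h.minor_of_common hx hy hi hj hc' hcx' hcy' hic' hjc'
  by_cases hjc : A j c = 0
  swap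
  · exact h.minor_of_common hx hy hi hj hc hcx hcy hic hjc
  by_cases h0 : A i x = 0 ∨ A j y = 0 ∨ A i y = 0 ∨ A j x = 0
  · exact h.minor_of_zero hi hj hx hy h0
  push Not at h0
  obtain ⟨hix, hjy, hiy, hjx⟩ := h0
  have hxy := h.ne
  have hir : i ≠ r := by rintro rfl; exact hrc' hic'
  have hjr : j ≠ r := by rintro rfl; exact hrc hjc
  have hcc : c' ≠ c := by rintro rfl; exact hic hic'
  have hij : r ≠ j := hjr.symm
  have hTic' := (h.entry hi hc').1 hic'
  have hTjc := (h.entry hj hc).1 hjc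
  have hTrc := (h.entry hr hc).not.1 hrc
  have hTrc' := (h.entry hr hc').not.1 hrc'
  have hTic := (h.entry hi hc).not.1 hic
  have hTjc' := (h.entry hj hc').not.1 hjc'
  have h1 := h.pivot hr hc hcx hcy hrc
  have h2 := h.pivot hr hc' hcx' hcy' hrc'
  have e1 : Paper.pivot A r c i c' = -(A i c * A r c' / A r c) := by
    rw [pivot_of_ne _ hir hcc, hic', zero_sub]
  have e1' : Paper.pivot T r c i c' = -(T i c * T r c' / T r c) := by
    rw [pivot_of_ne _ hir hcc, hTic', zero_sub]
  have e2 : Paper.pivot A r c' j c = -(A j c' * A r c / A r c') := by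
    rw [pivot_of_ne _ hjr hcc.symm, hjc, zero_sub]
  have k1 := h1.off_right.two (i := i) (i' := j) (j := c') (j' := x) (by simpa) (by simpa)
    (by simp [hc', hcy']) (by simp [hx, hxy])
  have k2 := h1.off_left.two (i := i) (i' := j) (j := c') (j' := y) (by simpa) (by simpa)
    (by simp [hc', hcx']) (by simp [hy, hxy.symm])
  have k3 := h1.minor_of_common hx hy hi hj hc' hcx' hcy' (by rw [e1]; simp [*])
    (by rwa [pivot_row_of_eq_zero hrc hjc])
  have k4 := h2.minor_of_common hx hy hi hj hc hcx hcy
    (by rwa [pivot_row_of_eq_zero hrc' hic']) (by rw [e2]; simp [*])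
  rw [e1, e1', pivot_row_of_eq_zero hrc hjc, pivot_row_of_eq_zero hrc hjc,
    pivot_row_of_eq_zero hTrc hTjc, pivot_row_of_eq_zero hTrc hTjc, pivot_of_ne _ hir hcx.symm,
    pivot_of_ne _ hir hcx.symm] at k1
  rw [e1, e1', pivot_row_of_eq_zero hrc hjc, pivot_row_of_eq_zero hrc hjc,
    pivot_row_of_eq_zero hTrc hTjc, pivot_row_of_eq_zero hTrc hTjc, pivot_of_ne _ hir hcy.symm,
    pivot_of_ne _ hir hcy.symm] at k2
  rw [pivot_row_of_eq_zero hrc hjc, pivot_row_of_eq_zero hrc hjc,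
    pivot_row_of_eq_zero hTrc hTjc, pivot_row_of_eq_zero hTrc hTjc, pivot_of_ne _ hir hcx.symm,
    pivot_of_ne _ hir hcx.symm, pivot_of_ne _ hir hcy.symm, pivot_of_ne _ hir hcy.symm] at k3
  rw [pivot_row_of_eq_zero hrc' hic', pivot_row_of_eq_zero hrc' hic',
    pivot_row_of_eq_zero hTrc' hTic', pivot_row_of_eq_zero hTrc' hTic',
    pivot_of_ne _ hjr hcx'.symm, pivot_of_ne _ hjr hcx'.symm, pivot_of_ne _ hjr hcy'.symm,
    pivot_of_ne _ hjr hcy'.symm] at k4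
  have g1 := h.noGeneric.pivot hi hc hic
  have g2 := h.noGeneric.pivot hj hc' hjc'
  have f1 : Paper.pivot A i c j c' ≠ 0 := by rwa [pivot_row_of_eq_zero hic hjc]
  have g3 := g1.pivot hj hc' f1
  have s1 := (g1 _ .refl).2 i r j x y hi hr hj hx hy
  have s2 := (g2 _ .refl).2 i r j x y hi hr hj hx hy
  have s3 := (g3 _ .refl).2 i r j x y hi hr hj hx hy
  have hp0 : Paper.pivot A i c i c' = 0 := by rw [pivot_row _ _ hcc, hic']
  simp only [pivot_row_of_eq_zero hic hjc, pivot_row A i hcx.symm, pivot_row A i hcy.symm,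
    pivot_of_ne A hir.symm hcx.symm, pivot_of_ne A hir.symm hcy.symm] at s1
  simp only [pivot_row_of_eq_zero hjc' hic', pivot_row A j hcx'.symm, pivot_row A j hcy'.symm,
    pivot_of_ne A hij hcx'.symm, pivot_of_ne A hij hcy'.symm] at s2
  simp only [pivot_row_of_eq_zero f1 hp0, pivot_row _ j hcx'.symm, pivot_row _ j hcy'.symm,
    pivot_of_ne _ hij hcx'.symm, pivot_of_ne _ hij hcy'.symm,
    pivot_col_of_eq_zero hic hic',
    pivot_row_of_eq_zero hic hjc, pivot_row A i hcx.symm, pivot_row A i hcy.symm,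
    pivot_of_ne A hir.symm hcx.symm, pivot_of_ne A hir.symm hcy.symm] at s3
  refine three_rows_minor two hic hrc hrc' hjc' hix hjx hiy hjy hTic hTrc hTrc' hTjc'
    ((h.entry hi hx).not.1 hix) ((h.entry hj hx).not.1 hjx) ((h.entry hi hy).not.1 hiy)
    ((h.entry hj hy).not.1 hjy) (h.entry hr hx) (h.entry hr hy)
    (h.off_right.two (by simpa) (by simpa) (by simp [hc, hcy]) (by simp [hx, hxy]))
    (h.off_left.two (by simpa) (by simpa) (by simp [hc, hcx]) (by simp [hy, hxy.symm]))
    (h.off_right.two (by simpa) (by simpa) (by simp [hc', hcy']) (by simp [hx, hxy]))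
    (h.off_left.two (by simpa) (by simpa) (by simp [hc', hcx']) (by simp [hy, hxy.symm]))
    k1 k2 (h.minor_of_common hx hy hi hr hc hcx hcy hic hrc)
    (h.minor_of_common hx hy hr hj hc' hcx' hcy' hrc' hjc')
    k3 k4 ((h.noGeneric A .refl).2 i r j x y hi hr hj hx hy) s1 s2 s3

lemma minor_of_walk (two : (2 : F) ≠ 0) (h : Glue S x y A T) (hx : Sum.inr x ∈ S)
    (hy : Sum.inr y ∈ S) {n : ℕ} {i j : R} (hi : Sum.inl i ∈ S) (hj : Sum.inl j ∈ S)
    (hw : Walk A (S \ {Sum.inr x, Sum.inr y}) n i j) :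
    A i x * A j y - A i y * A j x = 0 ↔ T i x * T j y - T i y * T j x = 0 := by
  induction n using Nat.strong_induction_on generalizing A T with
  | _ n ih =>
  rcases n with _ | n
  · obtain rfl : i = j := hw
    simp [mul_comm]
  obtain ⟨c₁, r₁, hc₁', hr₁', hic₁, hrc₁, hw₁⟩ := hw
  obtain ⟨hc₁, hcx₁, hcy₁⟩ : Sum.inr c₁ ∈ S ∧ c₁ ≠ x ∧ c₁ ≠ y := by simpa using hc₁'
  have hr₁ : Sum.inl r₁ ∈ S := hr₁'.1
  rcases n with _ | n
  · obtain rfl : r₁ = j := hw₁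
    exact h.minor_of_common hx hy hi hj hc₁ hcx₁ hcy₁ hic₁ hrc₁
  obtain ⟨c₂, r₂, hc₂', hr₂', hrc₁₂, hrc₂, hw₂⟩ := hw₁
  obtain ⟨hc₂, hcx₂, hcy₂⟩ : Sum.inr c₂ ∈ S ∧ c₂ ≠ x ∧ c₂ ≠ y := by simpa using hc₂'
  have hr₂ : Sum.inl r₂ ∈ S := hr₂'.1
  rcases n with _ | n
  · obtain rfl : r₂ = j := hw₂
    exact h.minor_of_path two hx hy hi hr₁ hj hc₁ hcx₁ hcy₁ hc₂ hcx₂ hcy₂ hic₁ hrc₁ hrc₁₂ hrc₂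
  obtain ⟨c₃, r₃, hc₃', hr₃', hrc₂₃, hrc₃, hw₃⟩ := hw₂
  by_cases h1 : A i c₂ = 0
  swap
  · exact ih (n + 2) (by lia) h ⟨c₂, r₂, hc₂', hr₂', h1, hrc₂, c₃, r₃, hc₃', hr₃', hrc₂₃, hrc₃, hw₃⟩
  by_cases h2 : A r₂ c₁ = 0
  swap
  · exact ih (n + 2) (by lia) h ⟨c₁, r₂, hc₁', hr₂', hic₁, h2, c₃, r₃, hc₃', hr₃', hrc₂₃, hrc₃, hw₃⟩
  by_cases h3 : A r₁ c₃ = 0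
  swap
  · exact ih (n + 2) (by lia) h ⟨c₁, r₁, hc₁', hr₁', hic₁, hrc₁, c₃, r₃, hc₃', hr₃', h3, hrc₃, hw₃⟩
  rcases hw₃.pivot_or_shortcut hr₃' hrc₂ with ⟨m, hm, s, hs, hsc, hw⟩ | ⟨h4, h5, hw⟩
  · exact ih (m + 2) (by lia) h ⟨c₁, r₁, hc₁', hr₁', hic₁, hrc₁, c₂, s, hc₂', hs, hrc₁₂, hsc, hw⟩
  have hrr : r₁ ≠ r₂ := by rintro rfl; exact hrc₁ h2
  have hcc : c₃ ≠ c₂ := by rintro rfl; exact hrc₁₂ h3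
  have := ih (n + 2) (by lia) (h.pivot hr₂ hc₂ hcx₂ hcy₂ hrc₂)
    ⟨c₁, r₁, hc₁', hr₁', by rwa [pivot_row_of_eq_zero hrc₂ h1],
      by rwa [pivot_col_of_eq_zero hrc₂ h2], c₃, r₃, hc₃', hr₃', ?_,
      by rwa [pivot_row_of_eq_zero hrc₂ h4], hw⟩
  · have hT := (h.entry hr₂ hc₂).not.1 hrc₂
    have h1' := (h.entry hi hc₂).1 h1
    have h5' := (h.entry hj hc₂).1 h5
    simpa only [pivot_row_of_eq_zero hrc₂ h1, pivot_row_of_eq_zero hrc₂ h5,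
      pivot_row_of_eq_zero hT h1', pivot_row_of_eq_zero hT h5'] using this
  · rw [pivot_of_ne _ hrr hcc, h3]
    simp [hrc₁₂, hrc₂, hrc₂₃]

/-- Synchronisation off the column `x` and off the column `y` implies synchronisation, provided
that removing both columns leaves a connected matrix. -/
theorem sync (two : (2 : F) ≠ 0) (h : Glue S x y A T) (hx : Sum.inr x ∈ S) (hy : Sum.inr y ∈ S)
    (hconn : Conn A (S \ {Sum.inr x, Sum.inr y})) : Sync S A T := by
  refine sync_of_pivot_closed
    (fun A T => Glue S x y A T ∧ Conn A (S \ {Sum.inr x, Sum.inr y})) {x, y}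
    (fun A T h i j hi hj => h.1.entry hi hj) ?_ ?_ ⟨h, hconn⟩
  · rintro A T ⟨h, hconn⟩ n f g hf hg hgX hginj
    have hxy := h.ne
    match n, f, g, hf, hg, hgX, hginj with
    | 0, f, g, hf, hg, hgX, hginj => simp
    | 1, f, g, hf, hg, hgX, hginj =>
      rw [Matrix.det_fin_one, Matrix.det_fin_one]
      exact h.entry (hf 0) (hg 0)
    | 2, f, g, hf, hg, hgX, hginj =>
      rw [Matrix.det_fin_two, Matrix.det_fin_two]
      simp only [Matrix.submatrix_apply]
      obtain ⟨m, hm⟩ := hconn.exists_walk (a := f 0) (b := f 1) (by simpa using hf 0)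
        (by simpa using hf 1)
      have key := h.minor_of_walk two hx hy (hf 0) (hf 1) hm
      have hne : g 0 ≠ g 1 := fun h01 => by simpa using hginj h01
      rcases hgX 0 with h0 | h0 <;> rcases hgX 1 with h1 | h1
      · exact absurd (h0.trans h1.symm) hne
      · rw [h0, h1]; exact key
      · rw [h0, h1, ← neg_eq_zero, neg_sub, ← neg_eq_zero (a := T _ _ * T _ _ - _), neg_sub]
        exact key
      · exact absurd (h0.trans h1.symm) hne
    | n + 3, f, g, hf, hg, hgX, hginj =>
      exfalso
      have h1 : Fintype.card (Fin (n + 3)) ≤ 2 := by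
        classical
        calc Fintype.card (Fin (n + 3)) = (Finset.univ.image g).card := by
              rw [Finset.card_image_of_injective _ hginj, Finset.card_univ]
          _ ≤ ({x, y} : Finset C).card := Finset.card_le_card fun z hz => by
              obtain ⟨k, -, rfl⟩ := Finset.mem_image.1 hz
              simpa using hgX k
          _ ≤ 2 := Finset.card_le_two
      simp at h1
  · rintro A T ⟨h, hconn⟩ r c hr hc hcX hA
    obtain ⟨hcx, hcy⟩ : c ≠ x ∧ c ≠ y := by simpa using hcX
    exact ⟨h.pivot hr hc hcx hcy hA, hconn.pivot (by simpa) (by simp [hc, hcx, hcy]) hA⟩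

end Glue

end Glue

end Paper

namespace Paper

section Finite

variable {R : Type*} {C : Type*} {F : Type*} [Field F] {A : Matrix R C F} {V : Set (R ⊕ C)}

lemma exists_sync_of_column_pair (two : (2 : F) ≠ 0) (hV : V.Finite) (hA : NoGeneric V A)
    (ih : ∀ V' ⊂ V, ∃ T : Matrix R C (ZMod 3), Sync V' A T) {x y : C} (hxy : x ≠ y)
    (hx : Sum.inr x ∈ V) (hy : Sum.inr y ∈ V) (hconn : Conn A (V \ {Sum.inr x, Sum.inr y})) :
    ∃ T : Matrix R C (ZMod 3), Sync V A T := by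
  classical
  obtain ⟨T₁, h₁⟩ := ih (V \ {Sum.inr x}) ⟨Set.sdiff_subset, fun h => (h hx).2 rfl⟩
  obtain ⟨T₂, h₂⟩ := ih (V \ {Sum.inr y}) ⟨Set.sdiff_subset, fun h => (h hy).2 rfl⟩
  obtain ⟨d, e, hd, he, hde⟩ := hconn.scaled (hV.subset Set.sdiff_subset)
    (h₂.mono (Set.sdiff_subset_sdiff_right (by simp)))
    (h₁.mono (Set.sdiff_subset_sdiff_right (by simp)))
  have hoff : ∀ {i j}, Sum.inl i ∈ V → Sum.inr j ∈ V → j ≠ x → j ≠ y →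
      T₁ i j = d i * T₂ i j * e j := fun hi hj hjx hjy => hde _ _ (by simpa) (by simp [*])
  refine ⟨Matrix.of fun i j => if j = x then d i * T₂ i j * e j else T₁ i j,
    Glue.sync two ⟨hxy, hA, h₁.congr ?_, (h₂.scale hd he).congr ?_⟩ hx hy hconn⟩
  · rintro i j - ⟨-, hj⟩
    have hjx : j ≠ x := by simpa using hj
    simp [hjx]
  · rintro i j ⟨hi, -⟩ ⟨hj, hjy⟩
    have hjy : j ≠ y := by simpa using hjy
    by_cases hjx : j = x
    · simp [hjx]
    · simp [hjx, hoff hi hj hjx hjy]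

lemma swap_preimage_swap_preimage (S : Set (R ⊕ C)) : Sum.swap ⁻¹' (Sum.swap ⁻¹' S) = S := by
  ext; simp

lemma exists_sync_of_hasBranch (two : (2 : F) ≠ 0) (hV : V.Finite) (hA : NoGeneric V A)
    (ih : ∀ V' ⊂ V, ∃ T : Matrix R C (ZMod 3), Sync V' A T) (hconn : Conn A V)
    (hbr : HasBranch A V) : ∃ T : Matrix R C (ZMod 3), Sync V A T := by
  obtain ⟨v, hv, N, hN, hN3, hadj⟩ := hbr
  rcases hconn.exists_pair hV hv hN hN3 hadj with ⟨x, y, hxy, hx, hy, h⟩ | ⟨x, y, hxy, hx, hy, h⟩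
  · exact exists_sync_of_column_pair two hV hA ih hxy hx hy h
  · have h' := h.transpose
    rw [Set.preimage_sdiff, show Sum.swap ⁻¹' {Sum.inl x, Sum.inl y} =
      ({Sum.inr x, Sum.inr y} : Set (C ⊕ R)) by ext u; rcases u with u | u <;> simp] at h'
    have ih' : ∀ V' ⊂ Sum.swap ⁻¹' V, ∃ T : Matrix C R (ZMod 3), Sync V' A.transpose T := by
      intro V' hV'
      obtain ⟨T, hT⟩ := ih (Sum.swap ⁻¹' V') ⟨fun u hu => by simpa using hV'.1 hu,
        fun h => hV'.2 fun u hu => by simpa using h hu⟩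
      exact ⟨T.transpose, by simpa [swap_preimage_swap_preimage] using hT.transpose⟩
    obtain ⟨T, hT⟩ := exists_sync_of_column_pair two
      (hV.preimage Sum.swap_leftInverse.injective.injOn) hA.transpose ih' hxy hx hy h'
    exact ⟨T.transpose, by simpa [swap_preimage_swap_preimage] using hT.transpose⟩

lemma exists_sync_of_not_conn (ih : ∀ V' ⊂ V, ∃ T : Matrix R C (ZMod 3), Sync V' A T)
    (hconn : ¬ Conn A V) : ∃ T : Matrix R C (ZMod 3), Sync V A T := by
  classical
  unfold Conn at hconn
  push Not at hconn
  obtain ⟨U, hUV, hU, hcl, hVU⟩ := hconn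
  obtain ⟨T₁, h₁⟩ := ih U ⟨hUV, hVU⟩
  obtain ⟨T₂, h₂⟩ := ih (V \ U) ⟨Set.sdiff_subset, fun h => by
    obtain ⟨u, hu⟩ := hU
    exact (h (hUV hu)).2 hu⟩
  refine ⟨Matrix.of fun i j => if Sum.inl i ∈ U then (if Sum.inr j ∈ U then T₁ i j else 0) else
    (if Sum.inr j ∈ U then 0 else T₂ i j), sync_of_pivot_closed
    (fun B T => Closed B V U ∧ Closed T V U ∧ Sync U B T ∧ Sync (V \ U) B T) ∅ ?_ ?_ ?_
    ⟨hcl, ?_, h₁.congr ?_, h₂.congr ?_⟩⟩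
  · rintro B T ⟨hB, hT, hs, hs'⟩ i j hi hj
    by_cases hiU : Sum.inl i ∈ U <;> by_cases hjU : Sum.inr j ∈ U
    · exact hs.entry hiU hjU
    · exact iff_of_true (by_contra fun h => hjU ((hB i j hi hj h).1 hiU))
        (by_contra fun h => hjU ((hT i j hi hj h).1 hiU))
    · exact iff_of_true (by_contra fun h => hiU ((hB i j hi hj h).2 hjU))
        (by_contra fun h => hiU ((hT i j hi hj h).2 hjU))
    · exact hs'.entry ⟨hi, hiU⟩ ⟨hj, hjU⟩
  · rintro B T - n f g - - hg -
    rcases n with _ | n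
    · simp
    · exact (hg 0).elim
  · rintro B T ⟨hB, hT, hs, hs'⟩ r c hr hc - hrc
    have hT0 : T r c ≠ 0 := by
      by_cases hrU : Sum.inl r ∈ U
      · exact (hs.entry_ne hrU ((hB r c hr hc hrc).1 hrU)).1 hrc
      · exact (hs'.entry_ne ⟨hr, hrU⟩ ⟨hc, fun h => hrU ((hB r c hr hc hrc).2 h)⟩).1 hrc
    refine ⟨hB.pivot hr hc hrc, hT.pivot hr hc hT0, ?_⟩
    by_cases hrU : Sum.inl r ∈ U
    · have hcU := (hB r c hr hc hrc).1 hrU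
      refine ⟨hs.pivot hrU hcU hrc, ?_⟩
      refine (((hs'.congr fun i j hi hj => ?_).symm).congr fun i j hi hj => ?_).symm
      · exact pivot_col_of_eq_zero hT0 (by_contra fun h => hj.2 ((hT r j hr hj.1 h).1 hrU)) i
      · exact pivot_col_of_eq_zero hrc (by_contra fun h => hj.2 ((hB r j hr hj.1 h).1 hrU)) i
    · have hcU : Sum.inr c ∉ U := fun h => hrU ((hB r c hr hc hrc).2 h)
      refine ⟨?_, hs'.pivot ⟨hr, hrU⟩ ⟨hc, hcU⟩ hrc⟩
      refine (((hs.congr fun i j hi hj => ?_).symm).congr fun i j hi hj => ?_).symm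
      · exact pivot_col_of_eq_zero hT0
          (by_contra fun h => hrU ((hT r j hr (hUV hj) h).2 hj)) i
      · exact pivot_col_of_eq_zero hrc
          (by_contra fun h => hrU ((hB r j hr (hUV hj) h).2 hj)) i
  · intro i j hi hj
    by_cases hiU : Sum.inl i ∈ U <;> by_cases hjU : Sum.inr j ∈ U <;> simp [hiU, hjU]
  · intro i j hi hj
    simp [hi, hj]
  · intro i j hi hj
    simp [hi.2, hj.2]

lemma exists_sync_of_support_empty (h : ∀ i j, Sum.inl i ∈ V → Sum.inr j ∈ V → A i j = 0) :
    ∃ T : Matrix R C (ZMod 3), Sync V A T := by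
  refine ⟨0, fun n f g hf hg => ?_⟩
  rcases n with _ | n
  · simp
  · exact iff_of_true (Matrix.det_eq_zero_of_row_eq_zero 0 fun j => h _ _ (hf 0) (hg j))
      (Matrix.det_eq_zero_of_row_eq_zero 0 fun j => rfl)

lemma exists_sync_of_subset_pairs {r r' : R} {c c' : C}
    (hV : V ⊆ {.inl r, .inl r', .inr c, .inr c'}) :
    ∃ T : Matrix R C (ZMod 3), Sync V A T := by
  classical
  obtain ⟨t, ht0, ht⟩ : ∃ t : ZMod 3, t ≠ 0 ∧ (t = 1 ↔ A r c * A r' c' - A r c' * A r' c = 0) := by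
    by_cases h : A r c * A r' c' - A r c' * A r' c = 0
    · exact ⟨1, by decide, by simp [h]⟩
    · exact ⟨2, by decide, by simp only [h, iff_false]; decide⟩
  let T : Matrix R C (ZMod 3) := fun i j => if A i j = 0 then 0 else
    if i = r' ∧ j = c' ∧ r ≠ r' ∧ c ≠ c' then t else 1
  have hT : ∀ i j, A i j = 0 ↔ T i j = 0 := by
    intro i j
    by_cases h : A i j = 0
    · simp [T, h]
    · simp only [T, h, if_false, false_iff]
      split_ifs
      exacts [ht0, one_ne_zero]
  have h2 : A r c * A r' c' - A r c' * A r' c = 0 ↔ T r c * T r' c' - T r c' * T r' c = 0 := by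
    by_cases hr : r = r'
    · subst hr; simp [mul_comm]
    by_cases hc : c = c'
    · subst hc; simp
    by_cases h0 : A r c = 0 ∨ A r' c' = 0 ∨ A r c' = 0 ∨ A r' c = 0
    · rcases h0 with h0 | h0 | h0 | h0 <;> have h0' := (hT _ _).1 h0 <;> simp [h0, h0', hT]
    · push Not at h0
      obtain ⟨h1, h2, h3, h4⟩ := h0
      rw [← ht]
      simp [T, h1, h2, h3, h4, hr, hc, sub_eq_zero]
  have hrow : ∀ i, Sum.inl i ∈ V → i = r ∨ i = r' := fun i hi => by simpa using hV hi
  have hcol : ∀ j, Sum.inr j ∈ V → j = c ∨ j = c' := fun j hj => by simpa using hV hj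
  refine ⟨T, fun n f g hf hg => ?_⟩
  by_cases hinj : Function.Injective f ∧ Function.Injective g
  swap
  · simp [det_submatrix_eq_zero_of_not_injective _ hinj]
  match n, f, g, hf, hg, hinj with
  | 0, f, g, _, _, _ => simp
  | 1, f, g, _, _, _ =>
    rw [Matrix.det_fin_one, Matrix.det_fin_one]
    exact hT _ _
  | 2, f, g, hf, hg, hinj =>
    have hf01 : f 0 ≠ f 1 := fun h => by simpa using hinj.1 h
    have hg01 : g 0 ≠ g 1 := fun h => by simpa using hinj.2 h
    rw [Matrix.det_fin_two, Matrix.det_fin_two]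
    simp only [Matrix.submatrix_apply]
    rcases hrow _ (hf 0) with h0 | h0 <;> rcases hrow _ (hf 1) with h1 | h1 <;>
    rcases hcol _ (hg 0) with h3 | h3 <;> rcases hcol _ (hg 1) with h4 | h4 <;>
    first
      | exact absurd (h0.trans h1.symm) hf01
      | exact absurd (h3.trans h4.symm) hg01
      | skip
    all_goals rw [h0, h1, h3, h4]
    · exact h2
    · rw [← neg_eq_zero, neg_sub, ← neg_eq_zero (a := T _ _ * T _ _ - _), neg_sub]
      exact h2
    · rw [← neg_eq_zero, neg_sub, ← neg_eq_zero (a := T _ _ * T _ _ - _), neg_sub,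
        mul_comm (A r' c'), mul_comm (A r' c), mul_comm (T r' c'), mul_comm (T r' c)]
      exact h2
    · rw [mul_comm (A r' c'), mul_comm (A r' c), mul_comm (T r' c'), mul_comm (T r' c)]
      exact h2
  | n + 3, f, g, hf, hg, hinj =>
    exfalso
    have h1 : Fintype.card (Fin (n + 3)) ≤ 2 :=
      calc Fintype.card (Fin (n + 3)) = (Finset.univ.image f).card := by
            rw [Finset.card_image_of_injective _ hinj.1, Finset.card_univ]
        _ ≤ ({r, r'} : Finset R).card := Finset.card_le_card fun z hz => by
            obtain ⟨k, -, rfl⟩ := Finset.mem_image.1 hz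
            simpa using hrow _ (hf k)
        _ ≤ 2 := Finset.card_le_two
    simp at h1

/-- If no sequence of pivots leads to a generic `2 × 3` or `3 × 2` submatrix, then there is a
ternary matrix with the same vanishing subdeterminants. -/
theorem exists_sync (two : (2 : F) ≠ 0) (hV : V.Finite) (hA : NoGeneric V A) :
    ∃ T : Matrix R C (ZMod 3), Sync V A T := by
  induction hn : V.ncard using Nat.strong_induction_on generalizing V A with
  | _ n ih =>
  subst hn
  have ih' : ∀ {B : Matrix R C F}, NoGeneric V B → ∀ V' ⊂ V,
      ∃ T : Matrix R C (ZMod 3), Sync V' B T := fun hB V' hV' =>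
    ih _ (Set.ncard_lt_ncard hV' hV) (hV.subset hV'.subset) (hB.mono hV'.subset) rfl
  by_cases hconn : Conn A V
  swap
  · exact exists_sync_of_not_conn (ih' hA) hconn
  by_cases h0 : ∃ r c, Sum.inl r ∈ V ∧ Sum.inr c ∈ V ∧ A r c ≠ 0
  swap
  · push Not at h0
    exact exists_sync_of_support_empty h0
  obtain ⟨r, c, hr, hc, hrc⟩ := h0
  rcases hconn.subset_or_hasBranch hr hc hrc with ⟨r, r', c, c', hsub⟩ | hbr |
    ⟨r, c, hr, hc, hrc, hbr⟩
  · exact exists_sync_of_subset_pairs hsub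
  · exact exists_sync_of_hasBranch two hV hA (ih' hA) hconn hbr
  · have hA' := hA.pivot hr hc hrc
    obtain ⟨T, hT⟩ := exists_sync_of_hasBranch two hV hA' (ih' hA') (hconn.pivot hr hc hrc) hbr
    refine ⟨pivot T r c, ?_⟩
    have := hT.pivot hr hc (by simpa [pivot_self] using hrc)
    rwa [pivot_pivot _ hrc] at this

end Finite

end Paper

namespace Paper

section Columns

variable {R : Type*} {C : Type*} {K : Type*} [Field K] {A : Matrix R C K}

open Classical in
/-- The columns of the matrix `[I | A]`. -/
noncomputable def column (A : Matrix R C K) : R ⊕ C → R → K :=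
  Sum.elim (fun i => Pi.single i 1) (fun j i => A i j)

open Classical in
/-- The row operation that clears the column `c` of `A` outside the row `r`. -/
noncomputable def clearColumn (A : Matrix R C K) (r : R) (c : C) : (R → K) →ₗ[K] (R → K) where
  toFun x i := if i = r then x r else x i - A i c / A r c * x r
  map_add' x y := by
    ext i
    by_cases hi : i = r
    · simp [hi]
    · simp [hi]; ring
  map_smul' t x := by
    ext i
    by_cases hi : i = r
    · simp [hi]
    · simp [hi]; ring

lemma clearColumn_injective (A : Matrix R C K) (r : R) (c : C) :
    Function.Injective (clearColumn A r c) := by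
  rw [← LinearMap.ker_eq_bot, LinearMap.ker_eq_bot']
  intro x hx
  have hr : x r = 0 := by simpa [clearColumn] using congrFun hx r
  ext i
  by_cases hi : i = r
  · rw [hi, hr, Pi.zero_apply]
  · simpa [clearColumn, hi, hr] using congrFun hx i

open Classical in
lemma linearIndepOn_column_pivot {r : R} {c : C} (h : A r c ≠ 0) (X : Set (R ⊕ C)) :
    LinearIndepOn K (column (pivot A r c)) X ↔
      LinearIndepOn K (column A) (Equiv.swap (Sum.inl r) (Sum.inr c) '' X) := by
  let w : R ⊕ C → Kˣ := fun u => if u = Sum.inl r then Units.mk0 (A r c) h else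
    if u = Sum.inr c then Units.mk0 (-(A r c)⁻¹) (by simpa) else 1
  have key : clearColumn A r c ∘ column A ∘ Equiv.swap (Sum.inl r) (Sum.inr c) =
      w • column (pivot A r c) := by
    funext u
    simp only [Function.comp_apply, Pi.smul_apply']
    rcases u with u | u
    · by_cases hu : u = r
      · subst hu
        rw [Equiv.swap_apply_left]
        ext i
        by_cases hi : i = u
        · simp [clearColumn, column, w, hi, Units.smul_def]
        · simp [clearColumn, column, w, hi, h]
      · rw [Equiv.swap_apply_of_ne_of_ne (by simpa) (by simp)]
        ext i
        by_cases hi : i = r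
        · simp [clearColumn, column, w, hi, hu]
        · simp [clearColumn, column, w, hi, hu, Pi.single_apply, Ne.symm hu]
    · by_cases hu : u = c
      · subst hu
        rw [Equiv.swap_apply_right]
        ext i
        by_cases hi : i = r
        · simp [clearColumn, column, w, hi, Units.smul_def, pivot_self, h]
        · simp [clearColumn, column, w, hi, Units.smul_def, pivot_col _ hi, div_eq_mul_inv,
            mul_comm]
      · rw [Equiv.swap_apply_of_ne_of_ne (by simp) (by simpa)]
        ext i
        by_cases hi : i = r
        · simp [clearColumn, column, w, hi, hu, pivot_row _ _ hu]
        · simp [clearColumn, column, w, hi, hu, pivot_of_ne _ hi hu]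
          ring
  rw [← linearIndepOn_equiv, iff_comm, LinearIndepOn, LinearIndepOn,
    ← LinearMap.linearIndependent_iff_of_injOn (clearColumn A r c)
      (clearColumn_injective A r c).injOn]
  rw [show (clearColumn A r c ∘ fun u : X => (column A ∘ Equiv.swap (Sum.inl r) (Sum.inr c)) u) =
    (fun u : X => w u) • fun u : X => column (pivot A r c) u from
      funext fun u => congrFun key u]
  exact LinearIndependent.units_smul_iff _ _

lemma linearIndepOn_column_of_subset_range_inl {X : Set (R ⊕ C)} (hX : X ⊆ range Sum.inl) :
    LinearIndepOn K (column A) X := by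
  classical
  refine LinearIndepOn.mono ?_ hX
  rw [linearIndepOn_range_iff Sum.inl_injective]
  exact Pi.linearIndependent_single_one R K

lemma linearIndepOn_column_insert {r : R} {c : C} (h : A r c ≠ 0) {X : Set (R ⊕ C)}
    (hr : Sum.inl r ∉ X) (hc : Sum.inr c ∉ X) :
    LinearIndepOn K (column A) (insert (Sum.inr c) X) ↔
      LinearIndepOn K (column (pivot A r c)) (insert (Sum.inl r) X) := by
  classical
  rw [linearIndepOn_column_pivot h, image_insert_eq, Equiv.swap_apply_left]
  have : EqOn (Equiv.swap (Sum.inl r) (Sum.inr c)) id X := fun u hu =>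
    Equiv.swap_apply_of_ne_of_ne (by rintro rfl; exact hr hu) (by rintro rfl; exact hc hu)
  rw [this.image_eq, image_id]

lemma not_linearIndepOn_column_insert [Finite R] {c : C} {X : Set (R ⊕ C)}
    (h : ∀ r, A r c ≠ 0 → Sum.inl r ∈ X) (hc : Sum.inr c ∉ X) :
    ¬ LinearIndepOn K (column A) (insert (Sum.inr c) X) := by
  classical
  have := Fintype.ofFinite R
  rw [linearIndepOn_insert hc]
  rintro ⟨-, h'⟩
  apply h'
  have : column A (Sum.inr c) = ∑ i, A i c • column A (Sum.inl i) := by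
    ext i
    simp [column, Pi.single_apply]
  rw [this]
  refine Submodule.sum_mem _ fun i _ => ?_
  by_cases hi : A i c = 0
  · simp [hi]
  · exact Submodule.smul_mem _ _ (Submodule.subset_span ⟨_, h i hi, rfl⟩)

/-- Matrices with the same vanishing subdeterminants have the same independent sets of columns. -/
lemma Sync.linearIndepOn_column [Finite R] [Finite C] {G : Type*} [Field G] {T : Matrix R C G}
    (h : Sync univ A T) (X : Set (R ⊕ C)) :
    LinearIndepOn K (column A) X ↔ LinearIndepOn G (column T) X := by
  induction hn : (X ∩ range Sum.inr).ncard using Nat.strong_induction_on generalizing A T X with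
  | _ n ih =>
  subst hn
  by_cases hX : X ⊆ range Sum.inl
  · exact iff_of_true (linearIndepOn_column_of_subset_range_inl hX)
      (linearIndepOn_column_of_subset_range_inl hX)
  · obtain ⟨c, hc⟩ : ∃ c, Sum.inr c ∈ X := by
      rw [not_subset] at hX
      obtain ⟨u, hu, hu'⟩ := hX
      rcases u with u | u
      · simp at hu'
      · exact ⟨u, hu⟩
    have hX' : X = insert (Sum.inr c) (X \ {Sum.inr c}) := by simp [insert_eq_of_mem hc]
    have hc' : Sum.inr c ∉ X \ {Sum.inr c} := by simp
    by_cases hr : ∃ r, A r c ≠ 0 ∧ Sum.inl r ∉ X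
    · obtain ⟨r, hr, hrX⟩ := hr
      have hT : T r c ≠ 0 := (h.entry_ne (mem_univ _) (mem_univ _)).1 hr
      have hrX' : Sum.inl r ∉ X \ {Sum.inr c} := fun h => hrX h.1
      rw [hX', linearIndepOn_column_insert hr hrX' hc', linearIndepOn_column_insert hT hrX' hc']
      refine ih _ ?_ (h.pivot (mem_univ _) (mem_univ _) hr) _ rfl
      refine ncard_lt_ncard ⟨?_, fun hsub => ?_⟩ (toFinite _)
      · rintro _ ⟨hu, j, rfl⟩
        exact ⟨by simpa using hu.resolve_left (by simp) |>.1, j, rfl⟩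
      · simpa using (hsub ⟨hc, mem_range_self c⟩).1
    · push Not at hr
      rw [hX']
      refine iff_of_false (not_linearIndepOn_column_insert (fun r hrc => ⟨hr r hrc, by simp⟩) hc')
        (not_linearIndepOn_column_insert (fun r hrc => ⟨hr r ?_, by simp⟩) hc')
      exact (h.entry_ne (mem_univ _) (mem_univ _)).2 hrc

lemma linearIndepOn_column_insert_inr {r : R} {c : C} (h : A r c ≠ 0) {X : Set (R ⊕ C)}
    (hX : X ⊆ range Sum.inl) (hr : Sum.inl r ∉ X) :
    LinearIndepOn K (column A) (insert (Sum.inr c) X) := by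
  rw [linearIndepOn_column_insert h hr fun h => by simpa using hX h]
  exact linearIndepOn_column_of_subset_range_inl (insert_subset (mem_range_self r) hX)

lemma linearIndepOn_column_insert_inr_insert_inr {r r' : R} {c c' : C} (h : A r c ≠ 0)
    (hdet : A r c * A r' c' - A r c' * A r' c ≠ 0) (hrr' : r ≠ r') (hcc' : c ≠ c')
    {X : Set (R ⊕ C)} (hX : X ⊆ range Sum.inl) (hr : Sum.inl r ∉ X) (hr' : Sum.inl r' ∉ X) :
    LinearIndepOn K (column A) (insert (Sum.inr c) (insert (Sum.inr c') X)) := by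
  rw [linearIndepOn_column_insert h (by simp [hr])
    (by simpa [hcc'] using fun h => by simpa using hX h), insert_comm]
  refine linearIndepOn_column_insert_inr (r := r') ?_ (insert_subset (mem_range_self r) hX)
    (by simp [hr', hrr'.symm])
  rw [pivot_of_ne _ hrr'.symm hcc'.symm]
  intro h0
  apply hdet
  field_simp at h0
  linear_combination h0

lemma ncard_le_of_linearIndepOn_column [Fintype R] [Finite C] {X : Set (R ⊕ C)}
    (hX : LinearIndepOn K (column A) X) : X.ncard ≤ Fintype.card R := by
  have := Fintype.ofFinite X
  have h := LinearIndependent.fintype_card_le_finrank hX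
  rwa [Module.finrank_fintype_fun_eq_card, ← Nat.card_eq_fintype_card, Nat.card_coe_set_eq] at h

end Columns

end Paper

namespace Paper

section Represents

variable {α : Type*} {R : Type*} {C : Type*} {K : Type*} [Field K] {A : Matrix R C K}
  {M : Matroid α} {ρ : R ⊕ C → α}

/-- The columns of `[I | A]`, labelled by `ρ`, represent a restriction of `M`. -/
structure Represents (M : Matroid α) (ρ : R ⊕ C → α) (A : Matrix R C K) : Prop where
  injective : Function.Injective ρ
  mem_ground : ∀ u, ρ u ∈ M.E
  indep_iff : ∀ X, M.Indep (ρ '' X) ↔ LinearIndepOn K (column A) X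

open Classical in
lemma Represents.pivot (h : Represents M ρ A) {r : R} {c : C} (hA : A r c ≠ 0) :
    Represents M (ρ ∘ Equiv.swap (Sum.inl r) (Sum.inr c)) (pivot A r c) where
  injective := h.injective.comp (Equiv.injective _)
  mem_ground _ := h.mem_ground _
  indep_iff X := by rw [linearIndepOn_column_pivot hA, image_comp, h.indep_iff]

lemma Represents.hasUniformMinor [Fintype R] [Fintype C] (h : Represents M ρ A) {P : Finset R}
    {Q : Finset C} {n : ℕ} (hn : P.card + Q.card = n) (hPQ : P.card ≤ 2 ∨ Q.card ≤ 2)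
    (h1 : ∀ r ∈ P, ∀ c ∈ Q, A r c ≠ 0)
    (h2 : ∀ r ∈ P, ∀ r' ∈ P, r ≠ r' → ∀ c ∈ Q, ∀ c' ∈ Q, c ≠ c' →
      A r c * A r' c' - A r c' * A r' c ≠ 0) : HasUniformMinor M P.card n := by
  classical
  have key : ∀ Z ⊆ P.disjSum Q, Z.card = P.card →
      LinearIndepOn K (column A) (↑(Pᶜ.disjSum ∅ ∪ Z) : Set (R ⊕ C)) := by
    intro Z hZ hZP
    have hF : Z.toLeft ⊆ P := fun i hi => by simpa using hZ (Finset.mem_toLeft.1 hi)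
    have hG : Z.toRight ⊆ Q := fun i hi => by simpa using hZ (Finset.mem_toRight.1 hi)
    have hcard : (P \ Z.toLeft).card = Z.toRight.card := by
      have h3 := Finset.card_sdiff_add_card_eq_card hF
      have h4 := Z.card_toLeft_add_card_toRight
      omega
    have hG2 : Z.toRight.card ≤ 2 := by
      rcases hPQ with hP | hQ
      · exact hcard ▸ (Finset.card_le_card Finset.sdiff_subset).trans hP
      · exact (Finset.card_le_card hG).trans hQ
    have hX : (↑(Pᶜ.disjSum ∅ ∪ Z) : Set (R ⊕ C)) =
        Sum.inr '' (Z.toRight : Set C) ∪ Sum.inl '' ((P \ Z.toLeft : Finset R) : Set R)ᶜ := by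
      ext u
      rcases u with u | u
      · simp; tauto
      · simp
    rw [hX]
    have hr : ∀ r ∈ P \ Z.toLeft,
        Sum.inl r ∉ (Sum.inl '' ((P \ Z.toLeft : Finset R) : Set R)ᶜ : Set (R ⊕ C)) := by
      intro r hr
      rw [Sum.inl_injective.mem_set_image]
      exact fun h => h hr
    have hs : ∀ r ∈ P \ Z.toLeft, r ∈ P := fun r hr => (Finset.mem_sdiff.1 hr).1
    generalize P \ Z.toLeft = D at *
    generalize Z.toRight = G at *
    have hG3 : G.card = 0 ∨ G.card = 1 ∨ G.card = 2 := by omega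
    rcases hG3 with hG3 | hG3 | hG3
    · rw [Finset.card_eq_zero.1 hG3]
      exact linearIndepOn_column_of_subset_range_inl (by simp)
    · obtain ⟨c, rfl⟩ := Finset.card_eq_one.1 hG3
      obtain ⟨r, rfl⟩ := Finset.card_eq_one.1 hcard
      rw [Finset.coe_singleton c, image_singleton, singleton_union]
      exact linearIndepOn_column_insert_inr (h1 r (hs r (by simp)) c (hG (by simp)))
        (image_subset_range _ _) (hr r (by simp))
    · obtain ⟨c, c', hcc', rfl⟩ := Finset.card_eq_two.1 hG3
      obtain ⟨r, r', hrr', rfl⟩ := Finset.card_eq_two.1 (hcard.trans hG3)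
      rw [Finset.coe_pair (a := c), image_pair, insert_union, singleton_union]
      exact linearIndepOn_column_insert_inr_insert_inr
        (h1 r (hs r (by simp)) c (hG (by simp)))
        (h2 r (hs r (by simp)) r' (hs r' (by simp)) hrr' c (hG (by simp)) c' (hG (by simp)) hcc')
        hrr' hcc' (image_subset_range _ _) (hr r (by simp)) (hr r' (by simp))
  have hdisj : Disjoint (Pᶜ.disjSum (∅ : Finset C)) (P.disjSum Q) := by
    rw [Finset.disjoint_left]
    rintro (u | u) <;> simp
  have hle : P.card ≤ (P.disjSum Q).card := by simp
  have hC0 : M.Indep (ρ '' ↑(Pᶜ.disjSum (∅ : Finset C))) := by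
    rw [h.indep_iff]
    exact linearIndepOn_column_of_subset_range_inl fun u hu => by
      rcases u with u | u
      · simp
      · simp at hu
  set C₀ : Finset (R ⊕ C) := Pᶜ.disjSum ∅ with hC₀
  set Y := P.disjSum Q with hY
  have hYE : ρ '' Y ⊆ M.E \ ρ '' C₀ := by
    rintro _ ⟨u, hu, rfl⟩
    refine ⟨h.mem_ground u, ?_⟩
    rw [h.injective.mem_set_image]
    exact fun hu' => Finset.disjoint_left.1 hdisj hu' hu
  have hE : (delete (contract M (ρ '' C₀)) ((M.E \ ρ '' C₀) \ ρ '' Y)).E = ρ '' Y := by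
    change (M.E \ ρ '' C₀) \ ((M.E \ ρ '' C₀) \ ρ '' Y) = _
    exact sdiff_sdiff_cancel_left hYE
  refine ⟨_, ⟨ρ '' C₀, (M.E \ ρ '' C₀) \ ρ '' Y, rfl⟩, ?_, ?_, ?_⟩
  · rw [hE]
    exact Y.finite_toSet.image _
  · rw [hE, ncard_image_of_injective _ h.injective, ncard_coe_finset, hY, Finset.card_disjSum, hn]
  · rw [hE]
    intro I hI
    obtain ⟨Z, hZ, rfl⟩ := subset_image_iff.1 hI
    lift Z to Finset (R ⊕ C) using toFinite Z
    rw [Finset.coe_subset] at hZ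
    have h3 : (delete (contract M (ρ '' C₀)) ((M.E \ ρ '' C₀) \ ρ '' Y)).Indep (ρ '' Z) ↔
        LinearIndepOn K (column A) (↑(C₀ ∪ Z) : Set (R ⊕ C)) := by
      change ((M ／ (ρ '' C₀)) ＼ ((M.E \ ρ '' C₀) \ ρ '' Y)).Indep (ρ '' Z) ↔ _
      rw [delete_indep_iff, hC0.contract_indep_iff, ← image_union, h.indep_iff, union_comm,
        Finset.coe_union]
      refine ⟨fun h => h.1.2, fun hl => ⟨⟨?_, hl⟩, ?_⟩⟩
      · exact disjoint_sdiff_left.mono_left (hI.trans hYE)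
      · exact disjoint_sdiff_right.mono_left hI
    rw [h3, ncard_image_of_injective _ h.injective, ncard_coe_finset]
    constructor
    · intro hl
      have h4 := ncard_le_of_linearIndepOn_column hl
      rw [ncard_coe_finset, Finset.card_union_of_disjoint (hdisj.mono_right hZ), hC₀,
        Finset.card_disjSum, Finset.card_compl] at h4
      have h5 := P.card_le_univ
      simp only [Finset.card_empty] at h4
      omega
    · intro hc
      obtain ⟨Z', hZZ', hZ'Y, hZ'⟩ := Finset.exists_subsuperset_card_eq hZ hc hle
      refine (key Z' hZ'Y hZ').mono ?_
      exact_mod_cast Finset.union_subset_union_right hZZ'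

lemma Represents.noGeneric [Fintype R] [Fintype C] (h : Represents M ρ A)
    (hM : NoLargeUniformMinors M) : NoGeneric univ A := by
  classical
  intro A' hA'
  obtain ⟨ρ', h'⟩ : ∃ ρ' : R ⊕ C → α, Represents M ρ' A' := by
    induction hA' with
    | refl => exact ⟨ρ, h⟩
    | tail _ hstep ih =>
      obtain ⟨ρ', h'⟩ := ih
      obtain ⟨r, c, -, -, hrc, rfl⟩ := hstep
      exact ⟨_, h'.pivot hrc⟩
  constructor
  · rintro i j a b c - - - - - ⟨⟨p1, p2, p3⟩, ⟨q1, q2, q3⟩, d1, d2, d3⟩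
    apply hM.1
    have hij : i ≠ j := by rintro rfl; exact d1 (by ring)
    have hab : a ≠ b := by rintro rfl; exact d1 (by ring)
    have hac : a ≠ c := by rintro rfl; exact d2 (by ring)
    have hbc : b ≠ c := by rintro rfl; exact d3 (by ring)
    have hP : ({i, j} : Finset R).card = 2 := Finset.card_pair hij
    have hQ : ({a, b, c} : Finset C).card = 3 :=
      Finset.card_eq_three.2 ⟨a, b, c, hab, hac, hbc, rfl⟩
    rw [← hP]
    refine h'.hasUniformMinor (Q := {a, b, c}) (by rw [hP, hQ]) (Or.inl hP.le) ?_ ?_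
    · simp [*]
    · simp only [Finset.mem_insert, Finset.mem_singleton]
      rintro r (rfl | rfl) r' (rfl | rfl) hr s (rfl | rfl | rfl) s' (rfl | rfl | rfl) hs <;>
        first
        | exact absurd rfl hr
        | exact absurd rfl hs
        | exact fun h0 => d1 (by linear_combination h0)
        | exact fun h0 => d1 (by linear_combination -h0)
        | exact fun h0 => d2 (by linear_combination h0)
        | exact fun h0 => d2 (by linear_combination -h0)
        | exact fun h0 => d3 (by linear_combination h0)
        | exact fun h0 => d3 (by linear_combination -h0)
  · rintro i j k a b - - - - - ⟨⟨p1, p2, p3⟩, ⟨q1, q2, q3⟩, d1, d2, d3⟩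
    apply hM.2
    have hab : a ≠ b := by rintro rfl; exact d1 (by ring)
    have hij : i ≠ j := by rintro rfl; exact d1 (by ring)
    have hik : i ≠ k := by rintro rfl; exact d2 (by ring)
    have hjk : j ≠ k := by rintro rfl; exact d3 (by ring)
    have hQ : ({a, b} : Finset C).card = 2 := Finset.card_pair hab
    have hP : ({i, j, k} : Finset R).card = 3 :=
      Finset.card_eq_three.2 ⟨i, j, k, hij, hik, hjk, rfl⟩
    rw [← hP]
    refine h'.hasUniformMinor (Q := {a, b}) (by rw [hP, hQ]) (Or.inr hQ.le) ?_ ?_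
    · simp [*]
    · simp only [Finset.mem_insert, Finset.mem_singleton]
      rintro r (rfl | rfl | rfl) r' (rfl | rfl | rfl) hr s (rfl | rfl) s' (rfl | rfl) hs <;>
        first
        | exact absurd rfl hr
        | exact absurd rfl hs
        | exact fun h0 => d1 (by linear_combination h0)
        | exact fun h0 => d1 (by linear_combination -h0)
        | exact fun h0 => d2 (by linear_combination h0)
        | exact fun h0 => d2 (by linear_combination -h0)
        | exact fun h0 => d3 (by linear_combination h0)
        | exact fun h0 => d3 (by linear_combination -h0)

end Represents

end Paper

namespace Paper

section Ternary

variable {α : Type*} {K : Type*} [Field K]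

/-- The labelling of a disjoint union of two subsets of `α`. -/
def label (I J : Set α) : I ⊕ J → α := Sum.elim Subtype.val Subtype.val

lemma label_injective {I J : Set α} (h : Disjoint I J) : Function.Injective (label I J) := by
  rintro (⟨i, hi⟩ | ⟨i, hi⟩) (⟨j, hj⟩ | ⟨j, hj⟩) hij <;>
    simp only [label, Sum.elim_inl, Sum.elim_inr] at hij
    <;> subst hij
  · rfl
  · exact absurd hj (h.notMem_of_mem_left hi)
  · exact absurd hi (h.notMem_of_mem_left hj)
  · rfl

lemma range_label (I J : Set α) : range (label I J) = I ∪ J := by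
  simp [label, Set.Sum.elim_range]

lemma linearIndepOn_image_label_iff {W : Type*} [AddCommGroup W] [Module K W] {ψ : α → W}
    {I J : Set α} [Fintype I] (hIJ : Disjoint I J) (hI : LinearIndepOn K ψ I) {A : Matrix I J K}
    (hA : ∀ j : J, ψ j = ∑ i : I, A i j • ψ i) (X : Set (I ⊕ J)) :
    LinearIndepOn K ψ (label I J '' X) ↔ LinearIndepOn K (column A) X := by
  have hinj : Function.Injective (Fintype.linearCombination K fun i : I => ψ i) := by
    exact linearIndependent_iff_injective_fintypeLinearCombination.1 hI
  have hcomp : ψ ∘ label I J = Fintype.linearCombination K (fun i : I => ψ i) ∘ column A := by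
    funext u
    rcases u with u | u
    · rw [Function.comp_apply, Function.comp_apply, Fintype.linearCombination_apply,
        Finset.sum_eq_single u]
      · simp [label, column]
      · intro i _ hi
        simp [column, hi]
      · simp
    · simp [label, column, Fintype.linearCombination_apply, hA u]
  rw [← LinearMap.linearIndepOn_iff_of_injOn (v := column A) _ hinj.injOn, ← hcomp]
  exact ⟨fun h => h.comp_of_image (label_injective hIJ).injOn, fun h => h.image_of_comp _ _⟩

/-- A family of coordinate vectors with respect to a base `B` of the represented matroid `M`. -/
structure Coordinates {V : Type*} [AddCommGroup V] [Module K V] (M : Matroid α) (φ : α → V)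
    (B : Set α) (l : α → α →₀ K) : Prop where
  isBase : M.IsBase B
  indep_iff : ∀ X ⊆ M.E, M.Indep X ↔ LinearIndepOn K φ X
  support_subset : ∀ e ∈ M.E \ B, ↑(l e).support ⊆ B
  eq_linearCombination : ∀ e ∈ M.E \ B, φ e = Finsupp.linearCombination K φ (l e)

lemma exists_coordinates {V : Type*} [AddCommGroup V] [Module K V] {M : Matroid α} {φ : α → V}
    (h : ∀ X ⊆ M.E, M.Indep X ↔ LinearIndepOn K φ X) : ∃ B l, Coordinates (K := K) M φ B l := by
  obtain ⟨B, hB⟩ := M.exists_isBase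
  have h1 : ∀ e, ∃ l : α →₀ K, e ∈ M.E \ B →
      ↑l.support ⊆ B ∧ φ e = Finsupp.linearCombination K φ l := by
    intro e
    by_cases he : e ∈ M.E \ B
    swap
    · exact ⟨0, fun h => absurd h he⟩
    have h2 : ¬ LinearIndepOn K φ (insert e B) := by
      rw [← h _ (insert_subset he.1 hB.subset_ground)]
      exact (hB.insert_dep he).not_indep
    rw [linearIndepOn_insert he.2, not_and, not_not] at h2
    obtain ⟨l, hl, hle⟩ := (Finsupp.mem_span_image_iff_linearCombination K).1
      (h2 ((h _ hB.subset_ground).1 hB.indep))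
    exact ⟨l, fun _ => ⟨hl, hle.symm⟩⟩
  choose l hl using h1
  exact ⟨B, l, hB, h, fun e he => (hl e he).1, fun e he => (hl e he).2⟩

namespace Coordinates

variable {V : Type*} [AddCommGroup V] [Module K V] {M : Matroid α} {φ : α → V} {B : Set α}
  {l : α → α →₀ K}

lemma indep_image_label_iff (h : Coordinates M φ B l) {I J : Set α} [Fintype I] (hI : I ⊆ B)
    (hJ : J ⊆ M.E \ B) (hIJ : ∀ j ∈ J, ↑(l j).support ⊆ I) (X : Set (I ⊕ J)) :
    M.Indep (label I J '' X) ↔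
      LinearIndepOn K (column (Matrix.of fun (i : I) (j : J) => l j i)) X := by
  rw [h.indep_iff]
  · refine linearIndepOn_image_label_iff (disjoint_sdiff_right.mono hI hJ)
      (((h.indep_iff _ h.isBase.subset_ground).1 h.isBase.indep).mono hI) ?_ X
    intro j
    rw [h.eq_linearCombination j (hJ j.2), Finsupp.linearCombination_apply, Finsupp.sum]
    simp only [Matrix.of_apply]
    rw [Finset.sum_set_coe I (f := fun i => l j i • φ i)]
    exact Finset.sum_subset (fun i hi => mem_toFinset.2 (hIJ j j.2 hi)) fun i _ hi => by
      rw [Finsupp.notMem_support_iff.1 hi, zero_smul]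
  · refine (image_subset_range _ _).trans ?_
    rw [range_label]
    exact union_subset (hI.trans h.isBase.subset_ground) (hJ.trans sdiff_subset)

lemma represents (h : Coordinates M φ B l) {I J : Set α} [Fintype I] (hI : I ⊆ B)
    (hJ : J ⊆ M.E \ B) (hIJ : ∀ j ∈ J, ↑(l j).support ⊆ I) :
    Represents M (label I J) (Matrix.of fun (i : I) (j : J) => l j i) where
  injective := label_injective (disjoint_sdiff_right.mono hI hJ)
  mem_ground u := by
    have : label I J u ∈ I ∪ J := range_label I J ▸ mem_range_self u
    exact this.elim (fun h' => h.isBase.subset_ground (hI h')) fun h' => (hJ h').1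
  indep_iff := h.indep_image_label_iff hI hJ hIJ

lemma exists_finite_sync (h : Coordinates M φ B l) (hM : NoLargeUniformMinors M)
    (two : (2 : K) ≠ 0) (s : Finset (α × α)) :
    ∃ T : Matrix α α (ZMod 3),
      Sync {u | Sum.elim (fun i => i ∈ B ∧ i ∈ Prod.fst '' (s : Set (α × α)))
        (fun j => j ∈ M.E \ B ∧ j ∈ Prod.snd '' (s : Set (α × α))) u}
      (Matrix.of fun i j => l j i) T := by
  classical
  let J : Set α := {j | j ∈ M.E \ B ∧ j ∈ Prod.snd '' (s : Set (α × α))}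
  let I : Set α := {i | i ∈ B ∧ i ∈ Prod.fst '' (s : Set (α × α))} ∪ ⋃ j ∈ J, ↑(l j).support
  have hJfin : J.Finite := (s.finite_toSet.image Prod.snd).subset fun j hj => hj.2
  have hIfin : I.Finite := ((s.finite_toSet.image Prod.fst).subset fun j hj => hj.2).union
    (hJfin.biUnion fun j _ => (l j).support.finite_toSet)
  have hJ : J ⊆ M.E \ B := fun j hj => hj.1
  have hI : I ⊆ B := union_subset (fun i hi => hi.1)
    (iUnion₂_subset fun j hj => h.support_subset j (hJ hj))
  have hIJ : ∀ j ∈ J, ↑(l j).support ⊆ I := fun j hj =>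
    (subset_biUnion_of_mem (u := fun j => ((l j).support : Set α)) hj).trans subset_union_right
  have := hIfin.fintype
  have := hJfin.fintype
  obtain ⟨T, hT⟩ := exists_sync two finite_univ ((h.represents hI hJ hIJ).noGeneric hM)
  refine ⟨Matrix.of fun i j => if hij : i ∈ I ∧ j ∈ J then T ⟨i, hij.1⟩ ⟨j, hij.2⟩ else 0, ?_⟩
  intro n f g hf hg
  have hf' : ∀ k, f k ∈ I := fun k => Or.inl (hf k)
  have hg' : ∀ k, g k ∈ J := fun k => hg k
  have h1 := hT n (fun k => ⟨f k, hf' k⟩) (fun k => ⟨g k, hg' k⟩) (fun _ => mem_univ _)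
    (fun _ => mem_univ _)
  have h2 : (Matrix.of fun i j =>
      if hij : i ∈ I ∧ j ∈ J then T ⟨i, hij.1⟩ ⟨j, hij.2⟩ else 0).submatrix
      f g = T.submatrix (fun k => ⟨f k, hf' k⟩) fun k => ⟨g k, hg' k⟩ := by
    ext a b
    simp [hf', hg']
  rw [h2]
  exact h1

lemma exists_sync (h : Coordinates M φ B l) (hM : NoLargeUniformMinors M) (two : (2 : K) ≠ 0) :
    ∃ T : Matrix α α (ZMod 3),
      Sync {u | Sum.elim (· ∈ B) (· ∈ M.E \ B) u} (Matrix.of fun i j => l j i) T := by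
  classical
  choose T hT using h.exists_finite_sync hM two
  obtain ⟨χ, hχ⟩ := Finset.rado_selection (β := fun _ : α × α => ZMod 3)
    fun s ij => T s ij.1 ij.2
  refine ⟨Matrix.of fun i j => χ (i, j), fun n f g hf hg => ?_⟩
  obtain ⟨t, hst, ht⟩ := hχ (Finset.univ.image f ×ˢ Finset.univ.image g)
  rw [hT t n f g (fun k => ?_) (fun k => ?_)]
  · have : (T t).submatrix f g = (Matrix.of fun i j => χ (i, j)).submatrix f g := by
      ext a b
      exact (ht (f a, g b) (by simp)).symm
    rw [this]
  · exact ⟨hf k, (f k, g k), hst (by simp), rfl⟩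
  · exact ⟨hg k, (f k, g k), hst (by simp), rfl⟩

lemma exists_ternary (h : Coordinates M φ B l) (hM : NoLargeUniformMinors M)
    (two : (2 : K) ≠ 0) :
    ∃ ψ : α → α → ZMod 3, ∀ X ⊆ M.E, M.Indep X ↔ LinearIndepOn (ZMod 3) ψ X := by
  classical
  obtain ⟨T, hT⟩ := h.exists_sync hM two
  let ψ : α → α → ZMod 3 := fun e =>
    if e ∈ B then Pi.single e 1 else fun r => if r ∈ B then T r e else 0
  have hψB : ∀ {e}, e ∈ B → ψ e = Pi.single e 1 := fun he => if_pos he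
  have hψ : LinearIndepOn (ZMod 3) ψ B := by
    have h1 : LinearIndepOn (ZMod 3) (fun e : α => (Pi.single e 1 : α → ZMod 3)) B :=
      (Pi.linearIndependent_single_one α (ZMod 3)).linearIndepOn B
    exact h1.congr fun e he => (hψB he).symm
  have hfin : ∀ X : Set α, X.Finite → X ⊆ M.E → (M.Indep X ↔ LinearIndepOn (ZMod 3) ψ X) := by
    intro X hX hXE
    let J : Set α := X \ B
    let I : Set α := (X ∩ B) ∪ ⋃ j ∈ J, ↑(l j).support
    have hJ : J ⊆ M.E \ B := sdiff_subset_sdiff_left hXE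
    have hI : I ⊆ B := union_subset inter_subset_right
      (iUnion₂_subset fun j hj => h.support_subset j (hJ hj))
    have hIJ : ∀ j ∈ J, ↑(l j).support ⊆ I := fun j hj =>
      (subset_biUnion_of_mem (u := fun j => ((l j).support : Set α)) hj).trans subset_union_right
    have hJfin : J.Finite := hX.subset sdiff_subset
    have hIfin : I.Finite := (hX.subset inter_subset_left).union
      (hJfin.biUnion fun j _ => (l j).support.finite_toSet)
    have := hIfin.fintype
    have := hJfin.fintype
    have hXIJ : X ⊆ range (label I J) := by
      rw [range_label]
      intro e he
      by_cases heB : e ∈ B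
      · exact Or.inl (Or.inl ⟨he, heB⟩)
      · exact Or.inr ⟨he, heB⟩
    rw [← image_preimage_eq_of_subset hXIJ, h.indep_image_label_iff hI hJ hIJ,
      linearIndepOn_image_label_iff (disjoint_sdiff_right.mono hI hJ) (hψ.mono hI)
        (A := Matrix.of fun (i : I) (j : J) => T i j)]
    · refine Sync.linearIndepOn_column (fun n f g _ _ => ?_) _
      exact hT n (fun k => f k) (fun k => g k) (fun k => hI (f k).2) (fun k => hJ (g k).2)
    · intro j
      ext r
      have hjB : (j : α) ∉ B := (hJ j.2).2
      have hsum : (∑ i : I, Matrix.of (fun (i : I) (j : J) => T i j) i j • ψ i) r =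
          ∑ i : I, if r = i then T i j else 0 := by
        simp [Finset.sum_apply, hψB (hI (Subtype.prop _)), Pi.single_apply]
      rw [hsum, show ψ j r = if r ∈ B then T r j else 0 by simp [ψ, hjB]]
      by_cases hr : r ∈ I
      · rw [Finset.sum_eq_single ⟨r, hr⟩ (fun i _ hi => if_neg fun h => hi (Subtype.ext h.symm))
          (fun h => absurd (Finset.mem_univ _) h), if_pos (hI hr), if_pos rfl]
      · rw [Finset.sum_eq_zero fun i _ => if_neg fun h => hr (by rw [h]; exact i.2)]
        split_ifs with hrB
        · exact (hT.entry (i := r) (j := (j : α)) hrB (hJ j.2)).1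
            (Finsupp.notMem_support_iff.1 fun h => hr (hIJ j j.2 h))
        · rfl
  refine ⟨ψ, fun X hX => ?_⟩
  rw [h.indep_iff X hX, linearIndepOn_iff_linearIndepOn_finset,
    linearIndepOn_iff_linearIndepOn_finset]
  refine forall₂_congr fun t ht => ?_
  rw [← h.indep_iff _ (ht.trans hX), hfin _ t.finite_toSet (ht.trans hX)]

end Coordinates

end Ternary

end Paper

namespace Paper

/-- Extension of scalars from the prime field to a field of characteristic three. -/
lemma Representable.of_zmod_three {α : Type u} {M : Matroid α} (h : Representable M (ZMod 3))
    (K : Type v) [Field K] (hK : ringChar K = 3) : Representable M K := by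
  obtain ⟨V, _, _, φ, hφ⟩ := h
  have : CharP K 3 := ringChar.of_eq hK
  let := ZMod.algebra K 3
  refine ⟨TensorProduct (ZMod 3) K V, inferInstance, inferInstance, fun e => 1 ⊗ₜ φ e,
    fun I hI => (hφ I hI).trans ⟨fun h => ?_, fun h => ?_⟩⟩
  · exact Module.Flat.linearIndependent_one_tmul h
  · have h1 := h.restrict_scalars' (ZMod 3)
    exact LinearIndependent.of_comp (TensorProduct.mk (ZMod 3) K V 1) h1

/-- A matroid without large uniform minors that is representable over a field of characteristic
other than two is ternary. -/
theorem Representable.zmod_three {α : Type u} {M : Matroid α} (hM : NoLargeUniformMinors M)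
    {K : Type v} [Field K] (two : (2 : K) ≠ 0) (h : Representable M K) :
    Representable M (ZMod 3) := by
  obtain ⟨V, _, _, φ, hφ⟩ := h
  obtain ⟨B, l, hl⟩ := exists_coordinates (K := K) hφ
  obtain ⟨ψ, hψ⟩ := hl.exists_ternary hM two
  exact ⟨α → ZMod 3, inferInstance, inferInstance, ψ, hψ⟩

lemma two_ne_zero_of_ringChar_eq_three {K : Type v} [Field K] (hK : ringChar K = 3) :
    (2 : K) ≠ 0 := by
  have : CharP K 3 := ringChar.of_eq hK
  intro h
  have := (CharP.cast_eq_zero_iff K 3 2).1 (by exact_mod_cast h)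
  omega

lemma ringChar_ulift_zmod_three : ringChar (ULift.{v} (ZMod 3)) = 3 := by
  have : CharP (ULift.{v} (ZMod 3)) 3 := inferInstance
  exact ringChar.eq _ 3

end Paper

/-- Let `M` be a matroid without large uniform minors. Then the following
are equivalent: (a) `M` is representable over `𝔽₃`; (b) `M` is representable over some
field of characteristic `3`; (c) `M` is representable over every field of
characteristic `3`. -/
theorem representable_F3_iff_some_char_three_iff_all_char_three
    {α : Type u} (M : Matroid α) (hM : Paper.NoLargeUniformMinors M) :
    (Paper.Representable M (ZMod 3) ↔
      ∃ (K : Type v) (_ : Field K), ringChar K = 3 ∧ Paper.Representable M K) ∧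
    (Paper.Representable M (ZMod 3) ↔
      ∀ (K : Type w) [Field K], ringChar K = 3 → Paper.Representable M K) := by
  refine ⟨⟨fun h => ?_, ?_⟩, fun h K _ hK => h.of_zmod_three K hK, fun h => ?_⟩
  · exact ⟨ULift.{v} (ZMod 3), inferInstance, Paper.ringChar_ulift_zmod_three,
      h.of_zmod_three _ Paper.ringChar_ulift_zmod_three⟩
  · rintro ⟨K, _, hK, h⟩
    exact h.zmod_three hM (Paper.two_ne_zero_of_ringChar_eq_three hK)
  · exact (h (ULift.{w} (ZMod 3)) Paper.ringChar_ulift_zmod_three).zmod_three hM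
      (Paper.two_ne_zero_of_ringChar_eq_three Paper.ringChar_ulift_zmod_three)
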